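/- arXiv:math/0110146 — 3 statements merged into one kernel-verified Lean document; each statement's English description precedes it below -/
import Mathlib

section
/- Every normalized bimonotone basic sequence (e_i)_{i∈ω} is 1-equivalent to an asymptotic model of c₀; that is, there is a basic array (y_i^n)_{n,i∈ω} in c₀ such that for every n and all scalars (b_j)_{j<n}, the iterated limit lim_{i_0→∞}⋯lim_{i_{n−1}→∞} ‖Σ_{j<n} b_j y_{i_j}^j‖_{c₀} exists and equals ‖Σ_{j<n} b_j e_j‖. -/
open Filter Finset Topology

variable {X : Type*} [NormedAddCommGroup X] [NormedSpace ℝ X]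
variable {E : Type*} [NormedAddCommGroup E] [NormedSpace ℝ E]

/-- `(x i)` is a `C`-basic sequence. -/
def IsCBasic (C : ℝ) (x : ℕ → X) : Prop :=
  (∀ i, x i ≠ 0) ∧
    ∀ n m : ℕ, n < m → ∀ a : ℕ → ℝ,
      ‖∑ i ∈ Finset.range n, a i • x i‖ ≤ C * ‖∑ i ∈ Finset.range m, a i • x i‖

/-- The finite sequence `y 0, …, y (m-1)` is `C`-basic. -/
def IsCBasicUpTo (C : ℝ) (m : ℕ) (y : ℕ → X) : Prop :=
  (∀ j, j < m → y j ≠ 0) ∧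
    ∀ n k : ℕ, n < k → k ≤ m → ∀ a : ℕ → ℝ,
      ‖∑ i ∈ Finset.range n, a i • y i‖ ≤ C * ‖∑ i ∈ Finset.range k, a i • y i‖

/-- `(x i)` is normalized. -/
def Normalized (x : ℕ → X) : Prop := ∀ i, ‖x i‖ = 1

/-- `x` is a `K`-basic array: each row `x n` is a normalized `K`-basic sequence and every
"diagonal" sequence `(x j (i j))_{j<m}` with `m ≤ i 0 < i 1 < ⋯` is `K`-basic. -/
def IsBasicArrayWith (K : ℝ) (x : ℕ → ℕ → X) : Prop :=
  (∀ n, Normalized (x n) ∧ IsCBasic K (x n)) ∧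
    ∀ (m : ℕ) (i : ℕ → ℕ), StrictMono i → m ≤ i 0 →
      IsCBasicUpTo K m fun j => x j (i j)

/-- `x` is a basic array if it is a `K`-basic array for some `K`. -/
def IsBasicArray (x : ℕ → ℕ → X) : Prop := ∃ K : ℝ, IsBasicArrayWith K x

/-- `IteratedLimit n f L`: the iterated limit `lim_{i₀→∞} ⋯ lim_{i_{n-1}→∞} f (i₀, …, i_{n-1})`
exists and equals `L`. -/
def IteratedLimit : ∀ n : ℕ, ((Fin n → ℕ) → ℝ) → ℝ → Prop
  | 0, f, L => f (fun i => i.elim0) = L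
  | n + 1, f, L => ∃ g : ℕ → ℝ,
      (∀ i₀ : ℕ, IteratedLimit n (fun t => f (Fin.cons i₀ t)) (g i₀)) ∧
      Filter.Tendsto g Filter.atTop (nhds L)

/-- The array `y` in `X` generates the asymptotic model `e`: all the iterated limits
`lim_{i₀→∞} ⋯ lim_{i_{n-1}→∞} ‖∑_{j<n} b j • y j (i j)‖` exist and equal
`‖∑_{j<n} b j • e j‖`. -/
def GeneratesAsymptoticModel (y : ℕ → ℕ → X) (e : ℕ → E) : Prop :=
  ∀ (n : ℕ) (b : ℕ → ℝ),
    IteratedLimit n (fun t => ‖∑ j : Fin n, b (j : ℕ) • y (j : ℕ) (t j)‖)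
      ‖∑ j ∈ Finset.range n, b j • e j‖

/-- `e` is an asymptotic model of `X`: it is a normalized basic sequence generated by
some basic array in `X`. -/
def IsAsymptoticModel (X : Type*) [NormedAddCommGroup X] [NormedSpace ℝ X]
    {E : Type*} [NormedAddCommGroup E] [NormedSpace ℝ E] (e : ℕ → E) : Prop :=
  Normalized e ∧ (∃ C : ℝ, IsCBasic C e) ∧
    ∃ y : ℕ → ℕ → X, IsBasicArray y ∧ GeneratesAsymptoticModel y e

/-- `(x i)` is bimonotone basic: it is 1-basic and the tail projections also have norm one. -/
def IsBimonotoneBasic (x : ℕ → X) : Prop :=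
  IsCBasic 1 x ∧
    ∀ n m : ℕ, n < m → ∀ a : ℕ → ℝ,
      ‖∑ i ∈ Finset.Ico n m, a i • x i‖ ≤ ‖∑ i ∈ Finset.range m, a i • x i‖

/-- The element of `c₀` that agrees with `w` below `c` and vanishes from `c` on. -/
noncomputable def truncation (w : ℕ → ℝ) (c : ℕ) : ZeroAtInftyContinuousMap ℕ ℝ where
  toFun N := if N < c then w N else 0
  continuous_toFun := continuous_of_discreteTopology
  zero_at_infty' := by
    rw [cocompact_eq_cofinite, Nat.cofinite_eq_atTop]
    refine tendsto_const_nhds.congr' ?_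
    filter_upwards [eventually_ge_atTop c] with N hN
    simp [not_lt.2 hN]

theorem truncation_apply (w : ℕ → ℝ) (c N : ℕ) :
    truncation w c N = if N < c then w N else 0 := rfl

theorem ZeroAtInftyContinuousMap.sum_apply {ι : Type*} (s : Finset ι)
    (g : ι → ZeroAtInftyContinuousMap ℕ ℝ) (N : ℕ) :
    (∑ i ∈ s, g i) N = ∑ i ∈ s, g i N := by
  classical
  induction s using Finset.induction_on with
  | empty => simp
  | insert a s ha ih => simp [Finset.sum_insert ha, ih]

theorem ZeroAtInftyContinuousMap.abs_apply_le_norm (g : ZeroAtInftyContinuousMap ℕ ℝ) (N : ℕ) :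
    |g N| ≤ ‖g‖ := by
  rw [← ZeroAtInftyContinuousMap.norm_toBCF_eq_norm]
  exact g.toBCF.norm_coe_le_norm N

theorem ZeroAtInftyContinuousMap.norm_le_of_abs_apply_le {g : ZeroAtInftyContinuousMap ℕ ℝ}
    {C : ℝ} (hC : 0 ≤ C) (h : ∀ N, |g N| ≤ C) : ‖g‖ ≤ C := by
  rw [← ZeroAtInftyContinuousMap.norm_toBCF_eq_norm]
  exact (BoundedContinuousFunction.norm_le hC).2 h

/-- A sequence of functionals `f` in the dual unit ball and cutoffs `c` such that every tail of `f`
norms the span of `e`, every block `[c m, c (m+1))` of `f` norms each of `e 0, …, e m`, and the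
first `c m` functionals norm the span of `e 0, …, e (m-1)` up to a factor `2`. -/
structure IsNormingSystem (e : ℕ → E) (f : ℕ → StrongDual ℝ E) (c : ℕ → ℕ) : Prop where
  norm_le (N : ℕ) : ‖f N‖ ≤ 1
  frequently_lt (x : E) (hx : x ∈ Submodule.span ℝ (Set.range e)) (r : ℝ) (hr : r < ‖x‖) (L : ℕ) :
    ∃ N, L ≤ N ∧ r < |f N x|
  strictMono : StrictMono c
  exists_lt (n : ℕ) : ∃ N < c n, |f N (e n)| = 1
  exists_mem_block (n m : ℕ) (h : n ≤ m) : ∃ N, c m ≤ N ∧ N < c (m + 1) ∧ |f N (e n)| = 1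
  exists_half_norming (m : ℕ) (x : E) (hx : x ∈ Submodule.span ℝ (e '' Set.Iio m)) :
    ∃ N < c m, ‖x‖ ≤ 2 * |f N x|

theorem IsBimonotoneBasic.norm_sum_Ico_le {e : ℕ → E} (h : IsBimonotoneBasic e) (a : ℕ → ℝ)
    {r s n : ℕ} (hrs : r ≤ s) :
    ‖∑ i ∈ Ico s n, a i • e i‖ ≤ ‖∑ i ∈ Ico r n, a i • e i‖ := by
  rcases le_or_gt n s with hn | hn
  · simp [Ico_eq_empty_of_le hn]
  · have key := h.2 s n hn fun i => if r ≤ i then a i else 0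
    have h₁ : ∑ i ∈ Ico s n, (if r ≤ i then a i else 0) • e i = ∑ i ∈ Ico s n, a i • e i := by
      refine sum_congr rfl fun i hi => ?_
      rw [if_pos (hrs.trans (mem_Ico.1 hi).1)]
    have h₂ : ∑ i ∈ range n, (if r ≤ i then a i else 0) • e i = ∑ i ∈ Ico r n, a i • e i := by
      simp only [ite_smul, zero_smul]
      rw [← sum_filter]
      congr 1
      ext i
      simp only [mem_filter, mem_range, mem_Ico]
      omega
    rwa [h₁, h₂] at key

theorem abs_dual_apply_le {g : StrongDual ℝ E} (hg : ‖g‖ ≤ 1) (x : E) : |g x| ≤ ‖x‖ := by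
  have := g.le_of_opNorm_le hg x
  rwa [one_mul] at this

theorem exists_dense_norming_sequence (e : ℕ → E) :
    ∃ (g : ℕ → StrongDual ℝ E) (k : ℕ → ℕ), (∀ i, ‖g i‖ ≤ 1) ∧ (∀ n, g (k n) (e n) = ‖e n‖) ∧
      ∀ x ∈ Submodule.span ℝ (Set.range e), ∀ r < ‖x‖, ∃ i, r < |g i x| := by
  obtain ⟨D, hDc, hD⟩ := (Set.countable_range e).isSeparable.span (R := ℝ)
  have hne : (D ∪ Set.range e).Nonempty := ⟨e 0, Or.inr ⟨0, rfl⟩⟩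
  obtain ⟨x, hx⟩ := (hDc.union (Set.countable_range e)).exists_eq_range hne
  choose g hg₁ hg₂ using fun i => exists_dual_vector'' ℝ (x i)
  have hk : ∀ n, ∃ i, x i = e n := fun n => by
    have : e n ∈ D ∪ Set.range e := Or.inr ⟨n, rfl⟩
    rwa [hx] at this
  choose k hk using hk
  refine ⟨g, k, hg₁, fun n => by rw [← hk n]; exact hg₂ _, fun y hy r hr => ?_⟩
  obtain ⟨z, hz, hyz⟩ := Metric.mem_closure_iff.1 (hD hy) ((‖y‖ - r) / 2) (by linarith)
  have hz' : z ∈ D ∪ Set.range e := Or.inl hz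
  rw [hx] at hz'
  obtain ⟨i, rfl⟩ := hz'
  refine ⟨i, lt_of_lt_of_le ?_ (le_abs_self _)⟩
  rw [dist_eq_norm] at hyz
  have h₁ : g i y = g i (y - x i) + ‖x i‖ := by
    rw [map_sub, hg₂ i]
    simp
  have h₂ := neg_le_of_abs_le (abs_dual_apply_le (hg₁ i) (y - x i))
  have h₃ : ‖y‖ ≤ ‖y - x i‖ + ‖x i‖ := by simpa using norm_add_le (y - x i) (x i)
  linarith

theorem exists_half_norming_initial_segment {V : Submodule ℝ E} [FiniteDimensional ℝ V]
    {g : ℕ → StrongDual ℝ E} (hg : ∀ x ∈ V, ∀ r < ‖x‖, ∃ i, r < |g i x|) :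
    ∃ d : ℕ, ∀ x ∈ V, ∃ i ≤ d, ‖x‖ ≤ 2 * |g i x| := by
  have : ProperSpace V := FiniteDimensional.proper_real V
  obtain ⟨t, ht⟩ := (isCompact_sphere (0 : V) 1).elim_finite_subcover
    (fun i => {x : V | 1 / 2 < |g i x|})
    (fun i => isOpen_lt continuous_const ((g i).continuous.comp continuous_subtype_val).abs)
    (fun x hx => by
      have hx : ‖(x : E)‖ = 1 := by simpa using hx
      obtain ⟨i, hi⟩ := hg x x.2 (1 / 2) (by rw [hx]; norm_num)
      exact Set.mem_iUnion.2 ⟨i, hi⟩)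
  refine ⟨t.sup id, fun x hx => ?_⟩
  rcases eq_or_ne x 0 with rfl | h0
  · exact ⟨0, Nat.zero_le _, by simp⟩
  have hpos : 0 < ‖x‖ := norm_pos_iff.2 h0
  have hmem : ‖x‖⁻¹ • (⟨x, hx⟩ : V) ∈ Metric.sphere (0 : V) 1 := by
    rw [mem_sphere_zero_iff_norm, norm_smul, norm_inv, norm_norm]
    exact inv_mul_cancel₀ hpos.ne'
  obtain ⟨i, hi, hlt⟩ := Set.mem_iUnion₂.1 (ht hmem)
  refine ⟨i, Finset.le_sup (f := id) hi, ?_⟩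
  have hlt : 1 / 2 < |g i (‖x‖⁻¹ • x)| := hlt
  rw [map_smul, smul_eq_mul, abs_mul, abs_inv, abs_norm, ← div_eq_inv_mul, lt_div_iff₀ hpos] at hlt
  linarith

theorem exists_isNormingSystem {e : ℕ → E} (he : Normalized e) :
    ∃ f c, IsNormingSystem e f c := by
  obtain ⟨g, k, hg, hk, hd⟩ := exists_dense_norming_sequence e
  have hfin : ∀ m, ∃ d : ℕ, ∀ x ∈ Submodule.span ℝ (e '' Set.Iio m), ∃ i ≤ d,
      ‖x‖ ≤ 2 * |g i x| := fun m => by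
    have : FiniteDimensional ℝ (Submodule.span ℝ (e '' Set.Iio m)) :=
      FiniteDimensional.span_of_finite ℝ ((Set.finite_Iio m).image e)
    exact exists_half_norming_initial_segment fun x hx =>
      hd x (Submodule.span_mono (Set.image_subset_range e _) hx)
  choose d hd' using hfin
  let h : ℕ → ℕ := fun m => ∑ j ∈ range (m + 1), (k j + d j)
  have hmono : Monotone h := fun a b hab =>
    sum_le_sum_of_subset (range_mono (by omega))
  have hle : ∀ n, k n + d n ≤ h n := fun n =>
    single_le_sum (f := fun j => k j + d j) (fun _ _ => Nat.zero_le _) (self_mem_range_succ n)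
  let c : ℕ → ℕ := fun m => (h m + m + 1) ^ 2
  have hone : ∀ n l, |g (Nat.unpair (Nat.pair (k n) l)).1 (e n)| = 1 := fun n l => by
    rw [Nat.unpair_pair, hk, he n, abs_one]
  have hlt : ∀ n i l, i ≤ h n → l ≤ h n + n → Nat.pair i l < c n := fun n i l hi hl =>
    (Nat.pair_lt_max_add_one_sq _ _).trans_le (Nat.pow_le_pow_left (by omega) 2)
  refine ⟨fun N => g (Nat.unpair N).1, c, ⟨fun N => hg _, fun x hx r hr L => ?_, fun a b hab => ?_,
    fun n => ⟨_, hlt n (k n) 0 (by have := hle n; omega) (by omega), hone n _⟩,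
    fun n m hnm => ⟨Nat.pair (k n) (h m + m + 1), ?_, hlt _ _ _ ?_ ?_, hone n _⟩,
    fun m x hx => ?_⟩⟩
  · obtain ⟨i, hi⟩ := hd x hx r hr
    exact ⟨Nat.pair i L, Nat.right_le_pair _ _, by rwa [Nat.unpair_pair]⟩
  · have := hmono hab.le
    exact Nat.pow_lt_pow_left (by omega) two_ne_zero
  · refine le_trans (Nat.pow_le_pow_left (le_max_right _ _) 2)
      ((Nat.le_add_right _ _).trans (Nat.max_sq_add_min_le_pair _ _))
  · have := hle n
    have := hmono (hnm.trans (Nat.le_add_right m 1))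
    omega
  · have := hmono (Nat.le_add_right m 1)
    omega
  · obtain ⟨i, hi, hx'⟩ := hd' m x hx
    exact ⟨Nat.pair i 0, hlt m i 0 (by have := hle m; omega) (by omega), by
      rwa [Nat.unpair_pair]⟩

namespace IsNormingSystem

variable {e : ℕ → E} {f : ℕ → StrongDual ℝ E} {c : ℕ → ℕ}

theorem abs_apply_le (hf : IsNormingSystem e f c) (N : ℕ) (x : E) : |f N x| ≤ ‖x‖ :=
  abs_dual_apply_le (hf.norm_le N) x

/-- The embedding `x ↦ (f N x)_N` of `E` into `ℓ_∞`. -/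
noncomputable def toBCF (hf : IsNormingSystem e f c) (x : E) : BoundedContinuousFunction ℕ ℝ :=
  BoundedContinuousFunction.ofNormedAddCommGroupDiscrete (fun N => f N x) ‖x‖
    fun N => hf.abs_apply_le N x

theorem toBCF_apply (hf : IsNormingSystem e f c) (x : E) (N : ℕ) : hf.toBCF x N = f N x := rfl

theorem norm_le_norm_toBCF_add (hf : IsNormingSystem e f c) {x : E}
    (hx : x ∈ Submodule.span ℝ (Set.range e)) (v : BoundedContinuousFunction ℕ ℝ) {M : ℕ}
    (hv : ∀ N, M ≤ N → v N = 0) : ‖x‖ ≤ ‖v + hf.toBCF x‖ := by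
  refine le_of_forall_lt fun r hr => ?_
  obtain ⟨N, hN, hlt⟩ := hf.frequently_lt x hx r hr M
  refine hlt.trans_le ?_
  have := (v + hf.toBCF x).norm_coe_le_norm N
  rwa [BoundedContinuousFunction.add_apply, hv N hN, zero_add] at this

theorem norm_toBCF (hf : IsNormingSystem e f c) {x : E}
    (hx : x ∈ Submodule.span ℝ (Set.range e)) : ‖hf.toBCF x‖ = ‖x‖ := by
  refine le_antisymm ((BoundedContinuousFunction.norm_le (norm_nonneg x)).2
    fun N => hf.abs_apply_le N x) ?_
  simpa using hf.norm_le_norm_toBCF_add hx 0 (M := 0) fun N _ => rfl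

theorem tendsto_norm_truncation (hf : IsNormingSystem e f c)
    {x z : E} (hxz : x + z ∈ Submodule.span ℝ (Set.range e)) (hz : ‖z‖ ≤ ‖x + z‖)
    (v : ZeroAtInftyContinuousMap ℕ ℝ) {M : ℕ} (hv : ∀ N, M ≤ N → v N = 0) :
    Tendsto (fun m => ‖(v + truncation (fun N => f N x) m).toBCF + hf.toBCF z‖) atTop
      (𝓝 ‖v.toBCF + hf.toBCF (x + z)‖) := by
  have hle := hf.norm_le_norm_toBCF_add hxz v.toBCF hv
  have hcoord : ∀ m N, ((v + truncation (fun N => f N x) m).toBCF + hf.toBCF z) N =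
      v N + (if N < m then f N x else 0) + f N z := fun m N => rfl
  have hcoord' : ∀ N, (v.toBCF + hf.toBCF (x + z)) N = v N + f N x + f N z := fun N => by
    change v N + f N (x + z) = _
    rw [map_add, add_assoc]
  refine tendsto_order.2 ⟨fun r hr => ?_, fun r hr => ?_⟩
  · rcases lt_or_ge r 0 with h0 | h0
    · exact Eventually.of_forall fun m => h0.trans_le (norm_nonneg _)
    have : ∃ N, r < ‖(v.toBCF + hf.toBCF (x + z)) N‖ := by
      by_contra! hcon
      exact hr.not_ge ((BoundedContinuousFunction.norm_le h0).2 hcon)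
    obtain ⟨N, hN⟩ := this
    filter_upwards [eventually_gt_atTop N] with m hm
    refine hN.trans_le ?_
    have := ((v + truncation (fun N => f N x) m).toBCF + hf.toBCF z).norm_coe_le_norm N
    rwa [hcoord, if_pos hm, ← hcoord'] at this
  · filter_upwards [eventually_ge_atTop M] with m hm
    refine lt_of_le_of_lt ((BoundedContinuousFunction.norm_le (norm_nonneg _)).2 fun N => ?_) hr
    rw [hcoord]
    split_ifs with h
    · rw [← hcoord']
      exact BoundedContinuousFunction.norm_coe_le_norm _ N
    · rw [hv N (by omega), zero_add, zero_add]
      exact (hf.abs_apply_le N z).trans (hz.trans hle)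

/-- The array in `c₀` obtained by truncating the coordinates of `e n` at `c (n + i)`. -/
noncomputable def array (_ : IsNormingSystem e f c) (n i : ℕ) : ZeroAtInftyContinuousMap ℕ ℝ :=
  truncation (fun N => f N (e n)) (c (n + i))

theorem array_apply (hf : IsNormingSystem e f c) (n i N : ℕ) :
    hf.array n i N = if N < c (n + i) then f N (e n) else 0 := rfl

theorem norm_array (hf : IsNormingSystem e f c) (he : Normalized e) (n i : ℕ) :
    ‖hf.array n i‖ = 1 := by
  refine le_antisymm (ZeroAtInftyContinuousMap.norm_le_of_abs_apply_le zero_le_one fun N => ?_) ?_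
  · rw [array_apply]
    split_ifs
    · exact (hf.abs_apply_le N _).trans_eq (he n)
    · simp
  · obtain ⟨N, hN, h1⟩ := hf.exists_lt n
    rw [← h1]
    have := (hf.array n i).abs_apply_le_norm N
    rwa [array_apply, if_pos (hN.trans_le (hf.strictMono.monotone (Nat.le_add_right _ _)))] at this

theorem span_mem (b : ℕ → ℝ) (s : Finset ℕ) :
    ∑ j ∈ s, b j • e j ∈ Submodule.span ℝ (Set.range e) :=
  Submodule.sum_mem _ fun j _ => Submodule.smul_mem _ _ (Submodule.subset_span ⟨j, rfl⟩)

theorem iteratedLimit_norm_add (hf : IsNormingSystem e f c) (hbm : IsBimonotoneBasic e)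
    (b : ℕ → ℝ) (n k : ℕ) (v : ZeroAtInftyContinuousMap ℕ ℝ) (M : ℕ)
    (hv : ∀ N, M ≤ N → v N = 0) :
    IteratedLimit n (fun t => ‖v + ∑ j : Fin n, b (k + j) • hf.array (k + j) (t j)‖)
      ‖v.toBCF + hf.toBCF (∑ j ∈ Ico k (k + n), b j • e j)‖ := by
  induction n generalizing k v M with
  | zero =>
    have : hf.toBCF 0 = 0 := by
      ext N
      simp [toBCF_apply]
    simp [IteratedLimit, this, ZeroAtInftyContinuousMap.norm_toBCF_eq_norm]
  | succ n ih =>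
    have hsum : ∑ j ∈ Ico k (k + (n + 1)), b j • e j =
        b k • e k + ∑ j ∈ Ico (k + 1) (k + 1 + n), b j • e j := by
      rw [sum_eq_sum_Ico_succ_bot (by omega), show k + (n + 1) = k + 1 + n by ring]
    have htrunc : ∀ i, b k • hf.array k i = truncation (fun N => f N (b k • e k)) (c (k + i)) :=
      fun i => by
        ext N
        simp only [ZeroAtInftyContinuousMap.smul_apply, array_apply, truncation_apply, map_smul]
        split_ifs <;> simp
    refine ⟨fun i₀ => ‖(v + b k • hf.array k i₀).toBCF +
      hf.toBCF (∑ j ∈ Ico (k + 1) (k + 1 + n), b j • e j)‖, fun i₀ => ?_, ?_⟩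
    · have key := ih (k + 1) (v + b k • hf.array k i₀) (max M (c (k + i₀))) fun N hN => ?_
      · convert key using 2 with t
        beta_reduce
        rw [Fin.sum_univ_succ, add_assoc]
        simp only [Fin.val_zero, add_zero, Fin.cons_zero, Fin.val_succ, Fin.cons_succ,
          Nat.add_right_comm k 1, ← Nat.add_assoc]
      · rw [ZeroAtInftyContinuousMap.add_apply, ZeroAtInftyContinuousMap.smul_apply, array_apply,
          hv N ((le_max_left _ _).trans hN), if_neg (not_lt.2 ((le_max_right _ _).trans hN))]
        simp
    · simp only [htrunc]
      rw [hsum]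
      refine (hf.tendsto_norm_truncation ?_ ?_ v hv).comp
        (g := fun m => ‖(v + truncation (fun N => f N (b k • e k)) m).toBCF + hf.toBCF _‖)
        (hf.strictMono.tendsto_atTop.comp (tendsto_atTop_mono (fun i => Nat.le_add_left i k)
          tendsto_id))
      · rw [← hsum]
        exact span_mem b _
      · rw [← hsum, show k + 1 + n = k + (n + 1) by ring]
        exact hbm.norm_sum_Ico_le b k.le_succ

theorem generatesAsymptoticModel_array (hf : IsNormingSystem e f c) (hbm : IsBimonotoneBasic e) :
    GeneratesAsymptoticModel hf.array e := by
  intro n b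
  have h := hf.iteratedLimit_norm_add hbm b n 0 0 0 fun N _ => rfl
  have h0 : (0 : ZeroAtInftyContinuousMap ℕ ℝ).toBCF = 0 := rfl
  simpa only [h0, zero_add, ← range_eq_Ico, hf.norm_toBCF (span_mem b _)] using h

theorem isCBasic_array (hf : IsNormingSystem e f c) (he : Normalized e) (n : ℕ) :
    IsCBasic 2 (hf.array n) := by
  refine ⟨fun i => norm_ne_zero_iff.1 (by rw [hf.norm_array he]; exact one_ne_zero),
    fun p q hpq a => ?_⟩
  set S := ∑ i ∈ range q, a i • hf.array n i with hS
  have hcoord : ∀ r N, (∑ i ∈ range r, a i • hf.array n i) N =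
      f N (e n) * ∑ i ∈ range r, if N < c (n + i) then a i else 0 := fun r N => by
    rw [ZeroAtInftyContinuousMap.sum_apply, mul_sum]
    refine sum_congr rfl fun i _ => ?_
    rw [ZeroAtInftyContinuousMap.smul_apply, array_apply]
    split_ifs <;> simp [mul_comm]
  have hw : ∀ N, |f N (e n)| ≤ 1 := fun N => (hf.abs_apply_le N _).trans_eq (he n)
  rcases Nat.eq_zero_or_pos p with rfl | hp
  · simp
  have htail : |∑ i ∈ Ico p q, a i| ≤ ‖S‖ := by
    obtain ⟨N, hN₁, hN₂, h1⟩ := hf.exists_mem_block n (n + (p - 1)) (Nat.le_add_right _ _)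
    rw [show n + (p - 1) + 1 = n + p by omega] at hN₂
    have hSN := S.abs_apply_le_norm N
    rw [hS, hcoord, abs_mul, h1, one_mul, ← sum_range_add_sum_Ico _ hpq.le,
      sum_eq_zero, zero_add] at hSN
    · refine le_of_eq_of_le (congrArg _ (sum_congr rfl fun i hi => ?_)) hSN
      rw [if_pos (hN₂.trans_le (hf.strictMono.monotone (by have := (mem_Ico.1 hi).1; omega)))]
    · intro i hi
      refine if_neg (not_lt.2 (le_trans (hf.strictMono.monotone ?_) hN₁))
      have := mem_range.1 hi
      omega
  refine ZeroAtInftyContinuousMap.norm_le_of_abs_apply_le (by positivity) fun N => ?_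
  rw [hcoord]
  rcases lt_or_ge N (c (n + p)) with hN | hN
  · have hSN := S.abs_apply_le_norm N
    have hsum : (∑ i ∈ Ico p q, if N < c (n + i) then a i else 0) = ∑ i ∈ Ico p q, a i :=
      sum_congr rfl fun i hi => if_pos (hN.trans_le (hf.strictMono.monotone (by
        have := (mem_Ico.1 hi).1; omega)))
    rw [hS, hcoord, ← sum_range_add_sum_Ico _ hpq.le, mul_add, hsum, ← hS] at hSN
    have h₂ : |f N (e n) * ∑ i ∈ Ico p q, a i| ≤ ‖S‖ := by
      rw [abs_mul]
      exact (mul_le_of_le_one_left (abs_nonneg _) (hw N)).trans htail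
    rw [abs_le] at *
    constructor <;> linarith [hSN.1, hSN.2, h₂.1, h₂.2]
  · rw [sum_eq_zero]
    · simp
    · intro i hi
      refine if_neg (not_lt.2 (le_trans (hf.strictMono.monotone ?_) hN))
      have := mem_range.1 hi
      omega

theorem norm_diagonal_sum_le (hf : IsNormingSystem e f c) (hbm : IsBimonotoneBasic e)
    {i : ℕ → ℕ} (hi : StrictMono i) (p : ℕ) (a : ℕ → ℝ) :
    ‖∑ j ∈ range p, a j • hf.array j (i j)‖ ≤ ‖∑ j ∈ range p, a j • e j‖ := by
  have hmono : StrictMono fun j => c (j + i j) := fun x y hxy =>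
    hf.strictMono (add_lt_add hxy (hi hxy))
  refine ZeroAtInftyContinuousMap.norm_le_of_abs_apply_le (norm_nonneg _) fun N => ?_
  have hex : ∃ s, N < c (s + i s) := ⟨N + 1, (Nat.lt_succ_self N).trans_le (hmono.id_le _)⟩
  have hs : ∀ j, N < c (j + i j) ↔ Nat.find hex ≤ j := fun j =>
    ⟨fun h => Nat.find_min' hex h, fun h => (Nat.find_spec hex).trans_le (hmono.monotone h)⟩
  have hcoord : (∑ j ∈ range p, a j • hf.array j (i j)) N =
      f N (∑ j ∈ Ico (Nat.find hex) p, a j • e j) := by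
    have hfilter : Ico (Nat.find hex) p = {j ∈ range p | Nat.find hex ≤ j} := by
      ext j
      simp only [mem_filter, mem_range, mem_Ico]
      omega
    rw [ZeroAtInftyContinuousMap.sum_apply, hfilter, sum_filter, map_sum]
    refine sum_congr rfl fun j _ => ?_
    rw [ZeroAtInftyContinuousMap.smul_apply, array_apply, if_congr (hs j) rfl rfl]
    split_ifs <;> simp
  rw [hcoord, range_eq_Ico]
  exact (hf.abs_apply_le N _).trans (hbm.norm_sum_Ico_le a (Nat.zero_le _))

theorem norm_sum_le_diagonal (hf : IsNormingSystem e f c)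
    {i : ℕ → ℕ} (hi : StrictMono i) {q : ℕ} (hq : q ≤ i 0) (a : ℕ → ℝ) :
    ‖∑ j ∈ range q, a j • e j‖ ≤ 2 * ‖∑ j ∈ range q, a j • hf.array j (i j)‖ := by
  obtain ⟨N, hN, hle⟩ := hf.exists_half_norming q (∑ j ∈ range q, a j • e j)
    (Submodule.sum_mem _ fun j hj => Submodule.smul_mem _ _
      (Submodule.subset_span ⟨j, mem_range.1 hj, rfl⟩))
  refine hle.trans (mul_le_mul_of_nonneg_left ?_ zero_le_two)
  refine le_trans (le_of_eq ?_) (ZeroAtInftyContinuousMap.abs_apply_le_norm _ N)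
  congr 1
  rw [ZeroAtInftyContinuousMap.sum_apply, map_sum]
  refine sum_congr rfl fun j _ => ?_
  have : q ≤ j + i j := by
    have := hi.monotone (Nat.zero_le j)
    omega
  rw [ZeroAtInftyContinuousMap.smul_apply, array_apply,
    if_pos (hN.trans_le (hf.strictMono.monotone this)), map_smul]

theorem isBasicArrayWith_array (hf : IsNormingSystem e f c) (he : Normalized e)
    (hbm : IsBimonotoneBasic e) : IsBasicArrayWith 2 hf.array := by
  refine ⟨fun n => ⟨hf.norm_array he n, hf.isCBasic_array he n⟩, fun m i hi hm =>
    ⟨fun j _ => norm_ne_zero_iff.1 (by rw [hf.norm_array he]; exact one_ne_zero),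
      fun p q hpq hqm a => ?_⟩⟩
  refine (hf.norm_diagonal_sum_le hbm hi p a).trans ?_
  refine le_trans ?_ (hf.norm_sum_le_diagonal hi (hqm.trans hm) a)
  simpa using hbm.1.2 p q hpq a

end IsNormingSystem

/-- Proposition 3.7: every normalized bimonotone basic sequence is 1-equivalent to an
asymptotic model of `c₀`; i.e. it is generated by a basic array in `c₀`. -/
theorem stmt_8 {E : Type*} [NormedAddCommGroup E] [NormedSpace ℝ E]
    (e : ℕ → E) (he : Normalized e) (hbm : IsBimonotoneBasic e) :
    ∃ y : ℕ → ℕ → ZeroAtInftyContinuousMap ℕ ℝ,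
      IsBasicArray y ∧ GeneratesAsymptoticModel y e := by
  obtain ⟨f, c, hf⟩ := exists_isNormingSystem he
  exact ⟨hf.array, ⟨2, hf.isBasicArrayWith_array he hbm⟩, hf.generatesAsymptoticModel_array hbm⟩
end

section
/- If (e_i)_{i∈ω} is an asymptotic model of ℓ₁ (generated by any basic array in ℓ₁), then (e_i)_{i∈ω} is equivalent to the unit vector basis of ℓ₁; in particular there exists δ > 0 such that ‖Σ_{i<n} a_i e_i‖ ≥ δ Σ_{i<n} |a_i| for all n and all scalars (a_i)_{i<n}. -/
open Filter Finset Topology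

variable {X : Type*} [NormedAddCommGroup X] [NormedSpace ℝ X]
variable {E : Type*} [NormedAddCommGroup E] [NormedSpace ℝ E]

instance : Fact ((1 : ENNReal) ≤ 1) := ⟨le_rfl⟩

/-- Adding a coordinatewise null net to a fixed vector of `ℓ₁` adds up the norms in the limit. -/
theorem tendsto_norm_add_sub_of_coord_tendsto_zero {ι : Type*} {l : Filter ι}
    (a : lp (fun _ : ℕ => ℝ) 1) (w : ι → lp (fun _ : ℕ => ℝ) 1)
    (hw : ∀ k, Tendsto (fun i => w i k) l (𝓝 0)) :
    Tendsto (fun i => ‖a + w i‖ - ‖w i‖ - ‖a‖) l (𝓝 0) := by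
  have hsum (x : lp (fun _ : ℕ => ℝ) 1) : HasSum (fun k => |x k|) ‖x‖ := by
    simpa using lp.hasSum_norm (p := 1) (by simp) x
  have hkey : Tendsto (fun i => ∑' k, (|a k + w i k| - |w i k| - |a k|)) l
      (𝓝 (∑' _ : ℕ, (0 : ℝ))) := by
    refine tendsto_tsum_of_dominated_convergence (bound := fun k => 2 * |a k|)
      ((hsum a).summable.mul_left 2) (fun k => ?_) (Eventually.of_forall fun i k => ?_)
    · have h := (((tendsto_const_nhds (x := a k)).add (hw k)).abs.sub (hw k).abs).sub
        (tendsto_const_nhds (x := |a k|))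
      simpa using h
    · rw [Real.norm_eq_abs, abs_le]
      have h₁ := abs_add_le (a k) (w i k)
      have h₂ := abs_add_le (a k + w i k) (-a k)
      rw [abs_neg, add_neg_cancel_comm] at h₂
      constructor <;> linarith [abs_nonneg (a k)]
  rw [tsum_zero] at hkey
  refine hkey.congr fun i => ?_
  simpa using (((hsum (a + w i)).sub (hsum (w i))).sub (hsum a)).tsum_eq

/-- Along an ultrafilter, a bounded family in `ℓ₁` converges coordinatewise to a vector
of `ℓ₁`. -/
theorem exists_coord_tendsto_of_norm_le {ι : Type*} (U : Ultrafilter ι)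
    (x : ι → lp (fun _ : ℕ => ℝ) 1) {C : ℝ} (hx : ∀ i, ‖x i‖ ≤ C) :
    ∃ z : lp (fun _ : ℕ => ℝ) 1, ∀ k, Tendsto (fun i => x i k) U (𝓝 (z k)) := by
  have hcoord (k : ℕ) : ∃ r : ℝ, Tendsto (fun i => x i k) U (𝓝 r) := by
    obtain ⟨r, -, hr⟩ := (isCompact_Icc (a := -C) (b := C)).ultrafilter_le_nhds
      (U.map fun i => x i k) (by
        rw [Ultrafilter.coe_map, le_principal_iff, Filter.mem_map]
        exact Eventually.of_forall fun i =>
          abs_le.mp ((lp.norm_apply_le_norm one_ne_zero (x i) k).trans (hx i)))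
    exact ⟨r, hr⟩
  choose r hr using hcoord
  have hmem : Memℓp r 1 := by
    refine lp.memℓp_of_tendsto (l := (U : Filter ι)) (F := x) ?_ (tendsto_pi_nhds.mpr hr)
    exact isBounded_iff_forall_norm_le.mpr ⟨C, by rintro _ ⟨i, rfl⟩; exact hx i⟩
  exact ⟨⟨r, hmem⟩, hr⟩

/-- Consecutive and non-consecutive terms of a normalized basic sequence are separated. -/
theorem IsCBasic.one_le_mul_norm_sub {K : ℝ} {x : ℕ → X} (hx : IsCBasic K x)
    (hn : Normalized x) {i j : ℕ} (hij : i < j) : 1 ≤ K * ‖x i - x j‖ := by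
  have h := hx.2 (i + 1) (j + 1) (by omega)
    (fun k => (if k = i then 1 else 0) + (if k = j then -1 else 0))
  simp only [add_smul, ite_smul, one_smul, zero_smul, neg_smul, sum_add_distrib,
    sum_ite_eq', mem_range] at h
  rw [if_pos (by omega), if_neg (by omega), if_pos (by omega), if_pos (by omega),
    add_zero, hn i, ← sub_eq_add_neg] at h
  exact h

theorem IsCBasic.constant_pos {K : ℝ} {x : ℕ → X} (hx : IsCBasic K x)
    (hn : Normalized x) : 0 < K :=
  pos_of_mul_pos_left (zero_lt_one.trans_le (hx.one_le_mul_norm_sub hn zero_lt_one))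
    (norm_nonneg _)

/-- The terms of a normalized basic sequence stay away from any fixed vector. -/
theorem IsCBasic.eventually_le_norm_sub {K : ℝ} {x : ℕ → X} (hx : IsCBasic K x)
    (hn : Normalized x) (z : X) : ∀ᶠ i in atTop, (2 * K)⁻¹ ≤ ‖x i - z‖ := by
  have hK := hx.constant_pos hn
  by_cases hall : ∀ i, (2 * K)⁻¹ ≤ ‖x i - z‖
  · exact Eventually.of_forall hall
  obtain ⟨i, hi⟩ := not_forall.mp hall
  filter_upwards [eventually_gt_atTop i] with j hj
  have hsep : K⁻¹ ≤ ‖x i - x j‖ := by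
    rw [inv_le_iff_one_le_mul₀ hK, mul_comm]
    exact hx.one_le_mul_norm_sub hn hj
  have htri : ‖x i - x j‖ ≤ ‖x i - z‖ + ‖x j - z‖ := by
    rw [norm_sub_rev (x j) z]
    exact norm_sub_le_norm_sub_add_norm_sub _ _ _
  have hhalf : K⁻¹ = (2 * K)⁻¹ + (2 * K)⁻¹ := by field_simp; norm_num
  linarith [not_le.mp hi]

/-- A normalized basic sequence in `ℓ₁` has, along a free ultrafilter, a coordinatewise limit `z`
whose translates satisfy an `ℓ₁`-type lower estimate. -/
theorem IsCBasic.exists_eventually_lower_estimate {K : ℝ} {x : ℕ → lp (fun _ : ℕ => ℝ) 1}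
    (hx : IsCBasic K x) (hn : Normalized x) :
    ∃ z : lp (fun _ : ℕ => ℝ) 1, ∀ (u : lp (fun _ : ℕ => ℝ) 1) (c ε : ℝ), 0 < ε →
      ∀ᶠ i in (hyperfilter ℕ : Filter ℕ),
        ‖u + c • z‖ + (2 * K)⁻¹ * |c| - ε ≤ ‖u + c • x i‖ := by
  obtain ⟨z, hz⟩ := exists_coord_tendsto_of_norm_le (hyperfilter ℕ) x fun i => (hn i).le
  refine ⟨z, fun u c ε hε => ?_⟩
  have hlim := tendsto_norm_add_sub_of_coord_tendsto_zero (l := (hyperfilter ℕ : Filter ℕ))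
    (u + c • z) (fun i => c • (x i - z)) fun k => by
      have h := ((hz k).sub_const (z k)).const_mul c
      rwa [sub_self, mul_zero] at h
  have hfar := Nat.hyperfilter_le_atTop (hx.eventually_le_norm_sub hn z)
  filter_upwards [hlim.eventually (lt_mem_nhds (neg_lt_zero.mpr hε)), hfar] with i h₁ h₂
  rw [show u + c • z + c • (x i - z) = u + c • x i by rw [smul_sub]; abel, norm_smul,
    Real.norm_eq_abs] at h₁
  have h₃ := mul_le_mul_of_nonneg_left h₂ (abs_nonneg c)
  linarith

/-- One-step lower estimates pass to iterated limits. -/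
theorem IteratedLimit.lower_estimate {l : Filter ℕ} [l.NeBot] (hl : l ≤ atTop) {d : ℝ} (n : ℕ)
    {y : ℕ → ℕ → X} {z : ℕ → X}
    (hyz : ∀ (j : ℕ) (u : X) (c ε : ℝ), 0 < ε →
      ∀ᶠ i in l, ‖u + c • z j‖ + d * |c| - ε ≤ ‖u + c • y j i‖)
    (v : X) (b : ℕ → ℝ) {L : ℝ}
    (hL : IteratedLimit n (fun t => ‖v + ∑ j : Fin n, b (j : ℕ) • y (j : ℕ) (t j)‖) L) :
    ‖v + ∑ j ∈ range n, b j • z j‖ + d * ∑ j ∈ range n, |b j| ≤ L := by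
  induction n generalizing y z v b L with
  | zero => simpa [IteratedLimit] using hL.le
  | succ n ih =>
    obtain ⟨g, hg, hgL⟩ := hL
    have hstep (i : ℕ) : ‖v + b 0 • y 0 i + ∑ j ∈ range n, b (j + 1) • z (j + 1)‖ +
        d * ∑ j ∈ range n, |b (j + 1)| ≤ g i := by
      refine ih (fun j => hyz (j + 1)) _ (fun j => b (j + 1)) ?_
      simpa [Fin.sum_univ_succ, add_assoc] using hg i
    refine le_of_forall_pos_sub_le fun ε hε => ge_of_tendsto (hgL.mono_left hl) ?_
    filter_upwards [hyz 0 (v + ∑ j ∈ range n, b (j + 1) • z (j + 1)) (b 0) ε hε] with i hi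
    refine le_trans ?_ (hstep i)
    rw [sum_range_succ', sum_range_succ', ← add_assoc, add_right_comm v (b 0 • y 0 i)]
    linarith

/-- Proposition 3.8: every asymptotic model of `ℓ₁` is equivalent to the unit vector basis
of `ℓ₁`; in particular there is `δ > 0` with `‖∑ a i • e i‖ ≥ δ * ∑ |a i|`. -/
theorem stmt_9 {E : Type*} [NormedAddCommGroup E] [NormedSpace ℝ E]
    (e : ℕ → E) (h : IsAsymptoticModel (lp (fun _ : ℕ => ℝ) 1) e) :
    (∃ A B : ℝ, 0 < A ∧ 0 < B ∧ ∀ (n : ℕ) (a : ℕ → ℝ),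
      A⁻¹ * (∑ i ∈ Finset.range n, |a i|) ≤ ‖∑ i ∈ Finset.range n, a i • e i‖ ∧
        ‖∑ i ∈ Finset.range n, a i • e i‖ ≤ B * ∑ i ∈ Finset.range n, |a i|) ∧
    ∃ δ : ℝ, 0 < δ ∧ ∀ (n : ℕ) (a : ℕ → ℝ),
      δ * (∑ i ∈ Finset.range n, |a i|) ≤ ‖∑ i ∈ Finset.range n, a i • e i‖ := by
  obtain ⟨hnorm, -, y, ⟨K, hK, -⟩, hgen⟩ := h
  have hKpos : 0 < K := (hK 0).2.constant_pos (hK 0).1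
  choose z hz using fun n => (hK n).2.exists_eventually_lower_estimate (hK n).1
  have hlower (n : ℕ) (a : ℕ → ℝ) :
      (2 * K)⁻¹ * (∑ i ∈ range n, |a i|) ≤ ‖∑ i ∈ range n, a i • e i‖ := by
    have h := IteratedLimit.lower_estimate Nat.hyperfilter_le_atTop n hz 0 a
      (by simpa using hgen n a)
    linarith [norm_nonneg (0 + ∑ j ∈ range n, a j • z j)]
  refine ⟨⟨2 * K, 1, by positivity, one_pos, fun n a => ⟨hlower n a, ?_⟩⟩,
    (2 * K)⁻¹, by positivity, hlower⟩
  rw [one_mul]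
  refine (norm_sum_le _ _).trans_eq (sum_congr rfl fun i _ => ?_)
  rw [norm_smul, hnorm i, mul_one, Real.norm_eq_abs]
end

section
/- Let (d_i)_{i∈ω} be a boundedly complete basis of a Banach space Y, regarded as the dual of the closed linear span of the biorthogonal functionals (d_i*), and let X ⊆ Y be a weak*-closed subspace. If some asymptotic model of X is equivalent to the unit vector basis of ℓ₁, then there is a basic array (x_i^n)_{n,i∈ω} in X, each of whose rows (x_i^n)_{i∈ω} is weak*-null, generating an asymptotic model equivalent to the unit vector basis of ℓ₁. -/
open Filter Finset Topology

variable {X : Type*} [NormedAddCommGroup X] [NormedSpace ℝ X]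
variable {E : Type*} [NormedAddCommGroup E] [NormedSpace ℝ E]

/-- A normed space over `ℝ`, bundled. -/
structure NormedSpc where
  carrier : Type
  [grp : NormedAddCommGroup carrier]
  [mod : NormedSpace ℝ carrier]

attribute [instance] NormedSpc.grp NormedSpc.mod

/-- `e` is equivalent to the unit vector basis of `ℓ₁`. -/
def EquivToL1Basis (e : ℕ → E) : Prop :=
  ∃ A B : ℝ, 0 < A ∧ 0 < B ∧ ∀ (n : ℕ) (c : ℕ → ℝ),
    A⁻¹ * (∑ i ∈ Finset.range n, |c i|) ≤ ‖∑ i ∈ Finset.range n, c i • e i‖ ∧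
      ‖∑ i ∈ Finset.range n, c i • e i‖ ≤ B * ∑ i ∈ Finset.range n, |c i|

/-- `x` is weak*-null with respect to the coordinate functionals `dstar`: it is bounded and
converges to `0` coordinatewise. -/
def WeakStarNull (dstar : ℕ → X →L[ℝ] ℝ) (x : ℕ → X) : Prop :=
  (∃ M : ℝ, ∀ i, ‖x i‖ ≤ M) ∧
    ∀ j, Filter.Tendsto (fun i => dstar j (x i)) Filter.atTop (nhds 0)


/-- The limit of a real sequence along a fixed nonprincipal ultrafilter on `ℕ`. -/
noncomputable def ulim (g : ℕ → ℝ) : ℝ := limUnder (hyperfilter ℕ : Filter ℕ) g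

theorem tendsto_ulim {g : ℕ → ℝ} {M : ℝ} (h : ∀ i, |g i| ≤ M) :
    Tendsto g (hyperfilter ℕ) (𝓝 (ulim g)) := by
  have hc : IsCompact (Set.Icc (-M) M) := isCompact_Icc
  obtain ⟨x, -, hx⟩ := hc.ultrafilter_le_nhds ((hyperfilter ℕ).map g) (by
    rw [le_principal_iff]
    exact Filter.Eventually.of_forall (f := (hyperfilter ℕ : Filter ℕ)) fun i => abs_le.1 (h i))
  exact tendsto_nhds_limUnder ⟨x, hx⟩

theorem ulim_eq {g : ℕ → ℝ} {L : ℝ} (h : Tendsto g (hyperfilter ℕ) (𝓝 L)) : ulim g = L :=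
  h.limUnder_eq

theorem hyperfilter_le_atTop : (hyperfilter ℕ : Filter ℕ) ≤ atTop :=
  Nat.cofinite_eq_atTop ▸ hyperfilter_le_cofinite

/-- A limit along the nonprincipal ultrafilter is attained along a subsequence. -/
theorem exists_subseq_of_tendsto_hyperfilter {Z : Type*} [TopologicalSpace Z]
    [FirstCountableTopology Z] {h : ℕ → Z} {z : Z}
    (hz : Tendsto h (hyperfilter ℕ) (𝓝 z)) :
    ∃ s : ℕ → ℕ, StrictMono s ∧ Tendsto (h ∘ s) atTop (𝓝 z) :=
  MapClusterPt.tendsto_subseq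
    (hz.mapClusterPt.mono hyperfilter_le_atTop)

/-- The iterated limit of `‖v + ∑_{j<n} b j • x j (i j)‖` along the nonprincipal ultrafilter. -/
noncomputable def ultraNorm : ℕ → (ℕ → ℝ) → (ℕ → ℕ → X) → X → ℝ
  | 0, _, _, v => ‖v‖
  | n + 1, b, x, v =>
      ulim fun i => ultraNorm n (fun j => b (j + 1)) (fun j => x (j + 1)) (v + b 0 • x 0 i)

section UltraNorm

variable {x : ℕ → ℕ → X} {M : ℝ}

theorem ultraNorm_bounds (hx : ∀ j i, ‖x j i‖ ≤ M) (n : ℕ) (b : ℕ → ℝ) (v : X) :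
    0 ≤ ultraNorm n b x v ∧ ultraNorm n b x v ≤ ‖v‖ + M * ∑ j ∈ range n, |b j| := by
  induction n generalizing b x v with
  | zero => simp [ultraNorm]
  | succ n ih =>
    have key : ∀ i, 0 ≤ ultraNorm n (fun j => b (j + 1)) (fun j => x (j + 1)) (v + b 0 • x 0 i) ∧
        ultraNorm n (fun j => b (j + 1)) (fun j => x (j + 1)) (v + b 0 • x 0 i) ≤
          ‖v‖ + M * ∑ j ∈ range (n + 1), |b j| := by
      intro i
      obtain ⟨h1, h2⟩ := ih (x := fun j => x (j + 1)) (fun j i => hx (j + 1) i)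
        (fun j => b (j + 1)) (v + b 0 • x 0 i)
      refine ⟨h1, h2.trans ?_⟩
      have h3 : ‖v + b 0 • x 0 i‖ ≤ ‖v‖ + |b 0| * M :=
        (norm_add_le _ _).trans (by
          rw [norm_smul, Real.norm_eq_abs]
          gcongr
          exact hx 0 i)
      rw [Finset.sum_range_succ']
      linarith
    have ht := tendsto_ulim (fun i => (abs_of_nonneg (key i).1).trans_le (key i).2)
    exact ⟨ge_of_tendsto' ht fun i => (key i).1, le_of_tendsto' ht fun i => (key i).2⟩

theorem tendsto_ultraNorm (hx : ∀ j i, ‖x j i‖ ≤ M) (n : ℕ) (b : ℕ → ℝ) (v : X) :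
    Tendsto (fun i => ultraNorm n (fun j => b (j + 1)) (fun j => x (j + 1)) (v + b 0 • x 0 i))
      (hyperfilter ℕ) (𝓝 (ultraNorm (n + 1) b x v)) := by
  have hM : 0 ≤ M := (norm_nonneg _).trans (hx 0 0)
  refine tendsto_ulim (M := ‖v‖ + |b 0| * M + M * ∑ j ∈ range n, |b (j + 1)|) fun i => ?_
  obtain ⟨h1, h2⟩ := ultraNorm_bounds (x := fun j => x (j + 1)) (fun j i => hx (j + 1) i) n
    (fun j => b (j + 1)) (v + b 0 • x 0 i)
  rw [abs_of_nonneg h1]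
  have h3 : ‖v + b 0 • x 0 i‖ ≤ ‖v‖ + |b 0| * M :=
    (norm_add_le _ _).trans (by
      rw [norm_smul, Real.norm_eq_abs]
      gcongr
      exact hx 0 i)
  linarith

theorem ultraNorm_add_le (hx : ∀ j i, ‖x j i‖ ≤ M) (n : ℕ) (b b' : ℕ → ℝ) (v v' : X) :
    ultraNorm n (fun j => b j + b' j) x (v + v') ≤ ultraNorm n b x v + ultraNorm n b' x v' := by
  induction n generalizing b b' x v v' with
  | zero => exact norm_add_le _ _
  | succ n ih =>
    refine le_of_tendsto_of_tendsto' (tendsto_ultraNorm hx n _ _)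
      ((tendsto_ultraNorm hx n b v).add (tendsto_ultraNorm hx n b' v')) fun i => ?_
    refine le_trans (le_of_eq ?_) (ih (fun j i => hx (j + 1) i) _ _ _ _)
    congr 1
    module

theorem ultraNorm_smul (hx : ∀ j i, ‖x j i‖ ≤ M) (n : ℕ) (c : ℝ) (b : ℕ → ℝ) (v : X) :
    ultraNorm n (fun j => c * b j) x (c • v) = |c| * ultraNorm n b x v := by
  induction n generalizing b x v with
  | zero => simp [ultraNorm, norm_smul]
  | succ n ih =>
    refine tendsto_nhds_unique (tendsto_ultraNorm hx n _ _)
      (((tendsto_ultraNorm hx n b v).const_mul |c|).congr fun i => ?_)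
    rw [← ih (fun j i => hx (j + 1) i)]
    congr 1
    module

theorem ultraNorm_congr (n : ℕ) {b b' : ℕ → ℝ} (h : ∀ j < n, b j = b' j) (v : X) :
    ultraNorm n b x v = ultraNorm n b' x v := by
  induction n generalizing b b' x v with
  | zero => rfl
  | succ n ih =>
    simp only [ultraNorm, h 0 n.succ_pos]
    congr 1
    funext i
    exact ih (fun j hj => h (j + 1) (by omega)) _

theorem ultraNorm_succ_of_last_eq_zero (n : ℕ) {b : ℕ → ℝ} (h : b n = 0) (v : X) :
    ultraNorm (n + 1) b x v = ultraNorm n b x v := by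
  induction n generalizing b x v with
  | zero =>
    simp only [ultraNorm, h, zero_smul, add_zero]
    exact ulim_eq tendsto_const_nhds
  | succ n ih =>
    rw [ultraNorm, ultraNorm]
    congr 1
    funext i
    exact ih h _

theorem ultraNorm_of_le {m n : ℕ} (hmn : m ≤ n) {b : ℕ → ℝ} (h : ∀ j, m ≤ j → b j = 0) (v : X) :
    ultraNorm n b x v = ultraNorm m b x v := by
  induction n, hmn using Nat.le_induction with
  | base => rfl
  | succ n hn ih => rw [ultraNorm_succ_of_last_eq_zero n (h n hn), ih]

theorem ultraNorm_add_of_zero_below (N n : ℕ) {b : ℕ → ℝ} (h : ∀ j < N, b j = 0) (v : X) :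
    ultraNorm (N + n) b x v = ultraNorm n (fun j => b (N + j)) (fun j => x (N + j)) v := by
  induction N generalizing b x with
  | zero => simp
  | succ N ih =>
    rw [show N + 1 + n = (N + n) + 1 by ring, ultraNorm, h 0 N.succ_pos]
    simp only [zero_smul, add_zero]
    rw [ulim_eq tendsto_const_nhds, ih fun j hj => h (j + 1) (by omega)]
    simp only [show ∀ j, N + j + 1 = N + 1 + j by intro j; ring]

theorem ultraNorm_single (n : ℕ) : ultraNorm (n + 1) (Pi.single n 1) x 0 =
    ulim fun i => ‖x n i‖ := by
  rw [ultraNorm_add_of_zero_below n 1 fun j hj => Pi.single_eq_of_ne hj.ne _]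
  simp [ultraNorm]

theorem abs_ultraNorm_sub_le (hx : ∀ j i, ‖x j i‖ ≤ M) (n : ℕ) (b b' : ℕ → ℝ) (v v' : X) :
    |ultraNorm n b x v - ultraNorm n b' x v'| ≤ ‖v - v'‖ + M * ∑ j ∈ range n, |b j - b' j| := by
  have aux : ∀ (b b' : ℕ → ℝ) (v v' : X), ultraNorm n b x v - ultraNorm n b' x v' ≤
      ‖v - v'‖ + M * ∑ j ∈ range n, |b j - b' j| := by
    intro b b' v v'
    have h1 := ultraNorm_add_le hx n b' (fun j => b j - b' j) v' (v - v')
    have h2 := (ultraNorm_bounds hx n (fun j => b j - b' j) (v - v')).2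
    simp only [add_sub_cancel] at h1
    linarith
  rw [abs_sub_le_iff]
  refine ⟨aux b b' v v', ?_⟩
  have := aux b' b v' v
  simpa only [abs_sub_comm (b' _) (b _), norm_sub_rev v' v] using this

/-- `ultraNorm` computes every iterated limit of norms which exists. -/
theorem ultraNorm_eq_of_iteratedLimit (n : ℕ) (b : ℕ → ℝ) (v : X) {L : ℝ}
    (h : IteratedLimit n (fun t => ‖v + ∑ j : Fin n, b j • x j (t j)‖) L) :
    ultraNorm n b x v = L := by
  induction n generalizing b x v L with
  | zero => simpa [IteratedLimit, ultraNorm] using h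
  | succ n ih =>
    obtain ⟨g, hg, hL⟩ := h
    refine ulim_eq ((hL.mono_left hyperfilter_le_atTop).congr fun i => Eq.symm ?_)
    refine ih (x := fun j => x (j + 1)) (fun j => b (j + 1)) (v + b 0 • x 0 i) ?_
    simpa [Fin.sum_univ_succ, add_assoc] using hg i

theorem ultraNorm_sub (n : ℕ) (b : ℕ → ℝ) (w : ℕ → X) (v : X) :
    ultraNorm n b (fun j i => x j i - w j) (v + ∑ j ∈ range n, b j • w j) =
      ultraNorm n b x v := by
  induction n generalizing b x w v with
  | zero => simp [ultraNorm]
  | succ n ih =>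
    simp only [ultraNorm]
    congr 1
    funext i
    rw [← ih (x := fun j => x (j + 1)) _ (fun j => w (j + 1)), Finset.sum_range_succ']
    congr 1
    module

theorem ultraNorm_mul (n : ℕ) (b c : ℕ → ℝ) (v : X) :
    ultraNorm n b (fun j i => c j • x j i) v = ultraNorm n (fun j => b j * c j) x v := by
  induction n generalizing b c x v with
  | zero => rfl
  | succ n ih =>
    simp only [ultraNorm, smul_smul]
    congr 1
    funext i
    exact ih (x := fun j => x (j + 1)) _ (fun j => c (j + 1)) _

theorem ultraNorm_eq_of_tendsto {x' : ℕ → ℕ → X} (hx : ∀ j i, ‖x j i‖ ≤ M)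
    (hx' : ∀ j i, ‖x' j i‖ ≤ M)
    (h : ∀ j, Tendsto (fun i => x j i - x' j i) (hyperfilter ℕ) (𝓝 0))
    (n : ℕ) (b : ℕ → ℝ) (v : X) : ultraNorm n b x v = ultraNorm n b x' v := by
  induction n generalizing b x x' v with
  | zero => rfl
  | succ n ih =>
    refine tendsto_nhds_unique (tendsto_ultraNorm hx n b v) ?_
    have h0 : Tendsto (fun i => |b 0| * ‖x 0 i - x' 0 i‖) (hyperfilter ℕ) (𝓝 0) := by
      simpa using (h 0).norm.const_mul |b 0|
    refine tendsto_of_tendsto_of_dist (tendsto_ultraNorm hx' n b v)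
      (squeeze_zero (fun _ => dist_nonneg) (fun i => ?_) h0)
    rw [ih (fun j => hx (j + 1)) (fun j => hx' (j + 1)) (fun j => h (j + 1)), dist_comm,
      Real.dist_eq]
    refine (abs_ultraNorm_sub_le (fun j => hx' (j + 1)) _ _ _ _ _).trans (le_of_eq ?_)
    rw [← Real.norm_eq_abs (b 0), ← norm_smul]
    simp [smul_sub]

end UltraNorm

section BasicSequences

theorem IsCBasic.comp_strictMono {C : ℝ} {z : ℕ → X} (hz : IsCBasic C z) {φ : ℕ → ℕ}
    (hφ : StrictMono φ) : IsCBasic C fun i => z (φ i) := by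
  refine ⟨fun i => hz.1 _, fun n m hnm a => ?_⟩
  have key : ∀ n, ∑ i ∈ range n, a i • z (φ i) =
      ∑ k ∈ range (φ n), Function.extend φ a 0 k • z k := by
    intro n
    have hsub : (range n).image φ ⊆ range (φ n) := by
      intro k hk
      obtain ⟨i, hi, rfl⟩ := Finset.mem_image.1 hk
      exact Finset.mem_range.2 (hφ (Finset.mem_range.1 hi))
    rw [← Finset.sum_subset hsub, Finset.sum_image fun i _ j _ h => hφ.injective h]
    · exact Finset.sum_congr rfl fun i _ => by rw [hφ.injective.extend_apply]
    · intro k hk hk'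
      rw [Function.extend_apply', Pi.zero_apply, zero_smul]
      rintro ⟨i, rfl⟩
      exact hk' (Finset.mem_image_of_mem _
        (Finset.mem_range.2 (hφ.lt_iff_lt.1 (Finset.mem_range.1 hk))))
  rw [key, key]
  exact hz.2 _ _ (hφ hnm) _

/-- An array whose entries, enumerated along `Nat.pair`, form a basic sequence is a basic array. -/
theorem isBasicArrayWith_of_isCBasic_unpair {K : ℝ} {x : ℕ → ℕ → X}
    (hnorm : ∀ j i, ‖x j i‖ = 1)
    (hx : IsCBasic K fun k => x (Nat.unpair k).1 (Nat.unpair k).2) : IsBasicArrayWith K x := by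
  refine ⟨fun n => ⟨hnorm n, ?_⟩, fun m i hi _ => ?_⟩
  · simpa using hx.comp_strictMono (φ := fun i => Nat.pair n i)
      fun _ _ h => Nat.pair_lt_pair_right _ h
  · have := hx.comp_strictMono (φ := fun j => Nat.pair j (i j))
      fun _ _ h => (Nat.pair_lt_pair_left _ h).trans (Nat.pair_lt_pair_right _ (hi h))
    simp only [Nat.unpair_pair] at this
    exact ⟨fun j _ => this.1 j, fun n k hnk _ => this.2 n k hnk⟩

/-- A normalized sequence which is almost block with respect to the uniformly bounded linear maps
`Q n` is basic. -/
theorem isCBasic_of_almost_block {C : ℝ} (Q : ℕ → X →ₗ[ℝ] X)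
    (hQ : ∀ n y, ‖Q n y‖ ≤ C * ‖y‖) {z : ℕ → X} (hz : ∀ k, ‖z k‖ = 1) {ε : ℕ → ℝ}
    (hε : ∀ m, ∑ k ∈ range m, ε k ≤ 1 / 4)
    (hlow : ∀ n k, n ≤ k → ‖Q n (z k)‖ ≤ ε k) (hhigh : ∀ n k, k < n → ‖z k - Q n (z k)‖ ≤ ε k) :
    IsCBasic (2 * C) z := by
  refine ⟨fun i h => by simpa [h] using hz i, fun n m hnm a => ?_⟩
  set w := ∑ i ∈ range m, a i • z i with hw
  obtain ⟨l, hl, hmax⟩ := Finset.exists_max_image (range m) (fun i => |a i|)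
    ⟨0, Finset.mem_range.2 (by omega)⟩
  have approx : ∀ n ≤ m, ‖∑ i ∈ range n, a i • z i - Q n w‖ ≤ |a l| / 4 := by
    intro n hn
    have h1 : ∑ i ∈ range n, a i • z i = ∑ i ∈ range m, a i • (if i < n then z i else 0) := by
      rw [← Finset.sum_subset (Finset.range_subset_range.2 hn)]
      · exact Finset.sum_congr rfl fun i hi => by rw [if_pos (Finset.mem_range.1 hi)]
      · intro i _ hi
        rw [if_neg (by simpa using hi), smul_zero]
    rw [h1, hw, map_sum, ← Finset.sum_sub_distrib]
    calc _ ≤ ∑ i ∈ range m, |a l| * ε i := by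
          refine norm_sum_le_of_le _ fun i hi => ?_
          rw [map_smul, ← smul_sub, norm_smul, Real.norm_eq_abs]
          refine mul_le_mul (hmax i hi) ?_ (norm_nonneg _) (abs_nonneg _)
          split_ifs with h
          · exact hhigh n i h
          · simpa using hlow n i (not_lt.1 h)
      _ ≤ _ := by
          rw [← Finset.mul_sum]
          have := mul_le_mul_of_nonneg_left (hε m) (abs_nonneg (a l))
          linarith
  have bound : ∀ n ≤ m, ‖∑ i ∈ range n, a i • z i‖ ≤ C * ‖w‖ + |a l| / 4 := by
    intro n hn
    have h1 := norm_le_norm_add_norm_sub' (∑ i ∈ range n, a i • z i) (Q n w)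
    linarith [approx n hn, hQ n w]
  have hal : |a l| ≤ 2 * (C * ‖w‖ + |a l| / 4) := by
    have h1 : a l • z l = ∑ i ∈ range (l + 1), a i • z i - ∑ i ∈ range l, a i • z i := by
      rw [Finset.sum_range_succ, add_sub_cancel_left]
    have h2 : |a l| = ‖a l • z l‖ := by rw [norm_smul, hz, mul_one, Real.norm_eq_abs]
    have hlm := Finset.mem_range.1 hl
    have h3 := norm_sub_le (∑ i ∈ range (l + 1), a i • z i) (∑ i ∈ range l, a i • z i)
    rw [← h1, ← h2] at h3
    linarith [bound (l + 1) hlm, bound l hlm.le]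
  have := bound n hnm.le
  linarith

end BasicSequences

section Basis

variable {d : ℕ → X} {dstar : ℕ → X →L[ℝ] ℝ} {C : ℝ}

/-- The partial sum projections of the basis `d`. -/
noncomputable def partialSum (d : ℕ → X) (dstar : ℕ → X →L[ℝ] ℝ) (n : ℕ) : X →ₗ[ℝ] X where
  toFun y := ∑ i ∈ range n, dstar i y • d i
  map_add' y z := by simp [add_smul, Finset.sum_add_distrib]
  map_smul' c y := by simp [mul_smul, Finset.smul_sum]

theorem norm_partialSum_le (hd : IsCBasic C d)
    (hexp : ∀ y : X, Tendsto (fun n => partialSum d dstar n y) atTop (𝓝 y)) (n : ℕ) (y : X) :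
    ‖partialSum d dstar n y‖ ≤ C * ‖y‖ :=
  ge_of_tendsto ((hexp y).norm.const_mul C)
    ((eventually_gt_atTop n).mono fun m hm => hd.2 n m hm fun i => dstar i y)

theorem separableSpace_of_basis
    (hexp : ∀ y : X, Tendsto (fun n => partialSum d dstar n y) atTop (𝓝 y)) :
    TopologicalSpace.SeparableSpace X := by
  rw [← TopologicalSpace.isSeparable_univ_iff]
  have h := ((Set.countable_range d).isSeparable.span (R := ℝ)).closure
  refine h.mono fun y _ => mem_closure_of_tendsto (hexp y) (Eventually.of_forall fun n => ?_)
  change ∑ i ∈ range n, dstar i y • d i ∈ Submodule.span ℝ (Set.range d)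
  exact Submodule.sum_mem _ fun i _ =>
    Submodule.smul_mem _ _ (Submodule.subset_span (Set.mem_range_self i))

/-- Bounded sequences have coordinatewise limits along the nonprincipal ultrafilter when the basis
is boundedly complete. -/
theorem exists_coordinatewise_ulim (hd : IsCBasic C d)
    (hbiorth : ∀ i j, dstar i (d j) = if i = j then (1 : ℝ) else 0)
    (hexp : ∀ y : X, Tendsto (fun n => partialSum d dstar n y) atTop (𝓝 y))
    (hbc : ∀ a : ℕ → ℝ, (∃ M : ℝ, ∀ n, ‖∑ i ∈ range n, a i • d i‖ ≤ M) →
      ∃ y : X, Tendsto (fun n => ∑ i ∈ range n, a i • d i) atTop (𝓝 y))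
    {u : ℕ → X} {M : ℝ} (hu : ∀ i, ‖u i‖ ≤ M) :
    ∃ w : X, ‖w‖ ≤ C * M ∧
      ∀ l, Tendsto (fun i => dstar l (u i)) (hyperfilter ℕ) (𝓝 (dstar l w)) := by
  have hC : 0 ≤ C := by
    have := norm_partialSum_le hd hexp 0 (d 0)
    exact nonneg_of_mul_nonneg_left ((norm_nonneg _).trans this) (norm_pos_iff.2 (hd.1 0))
  have hlim : ∀ l, Tendsto (fun i => dstar l (u i)) (hyperfilter ℕ)
      (𝓝 (ulim fun i => dstar l (u i))) := fun l =>
    tendsto_ulim (M := ‖dstar l‖ * M) fun i => by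
      rw [← Real.norm_eq_abs]
      exact ((dstar l).le_opNorm _).trans (by gcongr; exact hu i)
  have hpart : ∀ n, ‖∑ l ∈ range n, (ulim fun i => dstar l (u i)) • d l‖ ≤ C * M := fun n => by
    refine le_of_tendsto' (tendsto_finsetSum _ fun l _ => (hlim l).smul_const (d l)).norm
      fun i => (norm_partialSum_le hd hexp n (u i)).trans ?_
    gcongr
    exact hu i
  obtain ⟨w, hw⟩ := hbc (fun l => ulim fun i => dstar l (u i)) ⟨C * M, hpart⟩
  refine ⟨w, le_of_tendsto' hw.norm hpart, fun l => ?_⟩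
  have h1 := ((dstar l).continuous.tendsto w).comp hw
  have h2 : dstar l w = ulim fun i => dstar l (u i) := by
    refine tendsto_nhds_unique h1 (tendsto_const_nhds.congr'
      ((eventually_gt_atTop l).mono fun n hn => ?_))
    simp [hbiorth, hn]
  rw [h2]
  exact hlim l

/-- Basic sequences can be selected from coordinatewise null sequences. -/
theorem exists_isCBasic_selection (hd : IsCBasic C d)
    (hexp : ∀ y : X, Tendsto (fun n => partialSum d dstar n y) atTop (𝓝 y))
    {u : ℕ → ℕ → X} (hnorm : ∀ k, ∀ᶠ i in atTop, ‖u k i‖ = 1)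
    (hnull : ∀ k l, Tendsto (fun i => dstar l (u k i)) atTop (𝓝 0)) :
    ∃ m : ℕ → ℕ, (∀ k, k ≤ m k) ∧ (∀ k, ‖u k (m k)‖ = 1) ∧
      IsCBasic (2 * C) fun k => u k (m k) := by
  set ε : ℕ → ℝ := fun k => 1 / 4 * (1 / 2) ^ (k + 1) with hεdef
  have hεpos : ∀ k, 0 < ε k := fun k => by positivity
  have hε : ∀ m, ∑ k ∈ range m, ε k ≤ 1 / 4 := by
    intro m
    have : ∑ k ∈ range m, ε k = 1 / 4 * (1 - (1 / 2) ^ m) := by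
      induction m with
      | zero => simp
      | succ m ih => rw [Finset.sum_range_succ, ih, hεdef]; ring
    rw [this]
    have : (0 : ℝ) < (1 / 2) ^ m := by positivity
    linarith
  have hsmall : ∀ k N, ∃ m, k ≤ m ∧ ‖u k m‖ = 1 ∧
      ∀ n ≤ N, ‖partialSum d dstar n (u k m)‖ ≤ ε k := by
    intro k N
    have h1 : ∀ n, ∀ᶠ i in atTop, ‖partialSum d dstar n (u k i)‖ ≤ ε k := by
      intro n
      have : Tendsto (fun i => ‖partialSum d dstar n (u k i)‖) atTop (𝓝 0) := by
        simpa [partialSum] using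
          (tendsto_finsetSum (range n) fun l _ => (hnull k l).smul_const (d l)).norm
      exact (this.eventually (gt_mem_nhds (hεpos k))).mono fun i hi => le_of_lt hi
    have h2 : ∀ᶠ i in atTop, ∀ n ∈ Set.Iic N, ‖partialSum d dstar n (u k i)‖ ≤ ε k :=
      (Filter.eventually_all_finite (Set.finite_Iic N)).2 fun n _ => h1 n
    obtain ⟨m, h3, h4, h5⟩ := ((eventually_ge_atTop k).and ((hnorm k).and h2)).exists
    exact ⟨m, h3, h4, h5⟩
  choose mm hmk hm1 hmlow using hsmall
  have hlarge : ∀ k N, ∃ N', N ≤ N' ∧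
      ∀ n, N' ≤ n → ‖u k (mm k N) - partialSum d dstar n (u k (mm k N))‖ ≤ ε k := by
    intro k N
    have := (tendsto_iff_norm_sub_tendsto_zero.1 (hexp (u k (mm k N)))).eventually
      (gt_mem_nhds (hεpos k))
    obtain ⟨N', hN'⟩ := eventually_atTop.1 this
    exact ⟨max N N', le_max_left _ _, fun n hn => by
      rw [norm_sub_rev]
      exact (hN' n ((le_max_right _ _).trans hn)).le⟩
  choose NN hNN hNhigh using hlarge
  let Ns : ℕ → ℕ := fun k => Nat.rec 0 (fun k N => NN k N) k
  have hNs : ∀ k, Ns (k + 1) = NN k (Ns k) := fun k => rfl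
  have hmono : Monotone Ns := monotone_nat_of_le_succ fun k => hNN k (Ns k)
  refine ⟨fun k => mm k (Ns k), fun k => hmk _ _, fun k => hm1 _ _,
    isCBasic_of_almost_block (fun n => partialSum d dstar (Ns n))
      (fun n => norm_partialSum_le hd hexp _) (fun k => hm1 _ _) hε
      (fun n k hnk => hmlow _ _ _ (hmono hnk))
      (fun n k hkn => hNhigh _ _ _ ((hNs k).ge.trans (hmono hkn)))⟩

end Basis

section Subarrays

variable {x : ℕ → ℕ → X} {M : ℝ}

/-- The outermost limit in the definition of `ultraNorm` is realized along a subsequence, for all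
coefficients and all base points at once. -/
theorem exists_subseq_tendsto_ultraNorm [TopologicalSpace.SeparableSpace X]
    (hx : ∀ j i, ‖x j i‖ ≤ M) {f : ℕ → X →L[ℝ] ℝ}
    (hf : ∀ l, Tendsto (fun i => f l (x 0 i)) (hyperfilter ℕ) (𝓝 0)) :
    ∃ s : ℕ → ℕ, (∀ l, Tendsto (fun i => f l (x 0 (s i))) atTop (𝓝 0)) ∧
      ∀ (n : ℕ) (b : ℕ → ℝ) (v : X), Tendsto (fun i =>
        ultraNorm n (fun j => b (j + 1)) (fun j => x (j + 1)) (v + b 0 • x 0 (s i)))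
        atTop (𝓝 (ultraNorm (n + 1) b x v)) := by
  set D := TopologicalSpace.denseSeq ((ℕ → ℝ) × X) with hD
  set g : ℕ → (ℕ → ℝ) × X → ℕ → ℝ := fun n c i =>
    ultraNorm n (fun j => c.1 (j + 1)) (fun j => x (j + 1)) (c.2 + c.1 0 • x 0 i) with hg
  have hlim : Tendsto (fun i => ((fun l => f l (x 0 i) : ℕ → ℝ),
      (fun p => g p.1 (D p.2) i : ℕ × ℕ → ℝ))) (hyperfilter ℕ)
      (𝓝 ((fun _ => 0), fun p => ultraNorm (p.1 + 1) (D p.2).1 x (D p.2).2)) :=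
    (tendsto_pi_nhds.2 hf).prodMk_nhds
      (tendsto_pi_nhds.2 fun p => tendsto_ultraNorm hx p.1 (D p.2).1 (D p.2).2)
  obtain ⟨s, -, hs⟩ := exists_subseq_of_tendsto_hyperfilter hlim
  rw [nhds_prod_eq] at hs
  have hs1 := tendsto_pi_nhds.1 hs.fst
  have hs2 := tendsto_pi_nhds.1 hs.snd
  refine ⟨s, hs1, fun n b v => ?_⟩
  rw [Metric.tendsto_atTop]
  intro ε hε
  set δ : (ℕ → ℝ) × X → ℝ := fun c => ‖v - c.2‖ + M * ∑ j ∈ range (n + 1), |b j - c.1 j| with hδ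
  have hδc : Continuous δ := by fun_prop
  have hopen : IsOpen {c | δ c < ε / 3} := isOpen_lt hδc continuous_const
  obtain ⟨k, hc⟩ := (TopologicalSpace.denseRange_denseSeq _).exists_mem_open hopen
    ⟨(b, v), by simp [hδ, hε]⟩
  obtain ⟨N, hN⟩ := Metric.tendsto_atTop.1 (hs2 (n, k)) (ε / 3) (by positivity)
  refine ⟨N, fun i hi => ?_⟩
  have h1 := hN i hi
  have h2 : |g n (b, v) (s i) - g n (D k) (s i)| ≤ δ (D k) := by
    refine (abs_ultraNorm_sub_le (fun j => hx (j + 1)) _ _ _ _ _).trans ?_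
    have h3 : ‖v + b 0 • x 0 (s i) - ((D k).2 + (D k).1 0 • x 0 (s i))‖ ≤
        ‖v - (D k).2‖ + M * |b 0 - (D k).1 0| := by
      calc _ = ‖(v - (D k).2) + (b 0 - (D k).1 0) • x 0 (s i)‖ := by congr 1; module
        _ ≤ ‖v - (D k).2‖ + ‖x 0 (s i)‖ * |b 0 - (D k).1 0| := by
          refine (norm_add_le _ _).trans (le_of_eq ?_)
          rw [norm_smul, Real.norm_eq_abs, mul_comm]
        _ ≤ _ := by gcongr; exact hx 0 _
    simp only [hδ]
    rw [Finset.sum_range_succ', mul_add]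
    linarith
  have h4 := abs_ultraNorm_sub_le hx (n + 1) b (D k).1 v (D k).2
  change δ (D k) < ε / 3 at hc
  change dist (g n (D k) (s i)) _ < _ at h1
  change dist (g n (b, v) (s i)) _ < _
  rw [Real.dist_eq] at h1 ⊢
  change _ ≤ δ (D k) at h4
  rw [abs_lt] at h1 ⊢
  rw [abs_le] at h2 h4
  constructor <;> linarith

theorem iteratedLimit_ultraNorm {s : ℕ → ℕ → ℕ}
    (hs : ∀ (k n : ℕ) (b : ℕ → ℝ) (v : X), Tendsto (fun i =>
      ultraNorm n (fun j => b (j + 1)) (fun j => x (k + (j + 1))) (v + b 0 • x k (s k i)))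
      atTop (𝓝 (ultraNorm (n + 1) b (fun j => x (k + j)) v)))
    (n k : ℕ) (b : ℕ → ℝ) (v : X) :
    IteratedLimit n (fun t => ‖v + ∑ j : Fin n, b j • x (k + j) (s (k + j) (t j))‖)
      (ultraNorm n b (fun j => x (k + j)) v) := by
  induction n generalizing k b v with
  | zero => simp [IteratedLimit, ultraNorm]
  | succ n ih =>
    refine ⟨_, fun i => ?_, hs k n b v⟩
    have := ih (k + 1) (fun j => b (j + 1)) (v + b 0 • x k (s k i))
    simpa [Fin.sum_univ_succ, add_assoc, add_comm, add_left_comm] using this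

end Subarrays

section Model

variable {x : ℕ → ℕ → X} {M : ℝ}

/-- A norm on a vector space gives rise to a bundled normed space. -/
theorem exists_normedSpc_of_core {V : Type} [AddCommGroup V] [Module ℝ V] [Norm V]
    (core : NormedSpace.Core ℝ V) :
    ∃ (E : NormedSpc) (T : V →ₗ[ℝ] E.carrier), ∀ b, ‖T b‖ = ‖b‖ := by
  let inst : NormedAddCommGroup V := NormedAddCommGroup.ofCore core
  let inst' : NormedSpace ℝ V := NormedSpace.ofCore core
  exact ⟨NormedSpc.mk V, LinearMap.id, fun _ => rfl⟩

/-- The norm on finitely supported sequences induced by `ultraNorm`. -/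
theorem exists_normedSpc_ultraNorm (hx : ∀ j i, ‖x j i‖ ≤ M) {δ : ℝ} (hδ : 0 < δ)
    (hlow : ∀ (n : ℕ) (b : ℕ → ℝ), δ * ∑ j ∈ range n, |b j| ≤ ultraNorm n b x 0) :
    ∃ (E : NormedSpc) (e : ℕ → E.carrier), ∀ (n : ℕ) (b : ℕ → ℝ),
      ‖∑ j ∈ range n, b j • e j‖ = ultraNorm n b x 0 := by
  let p : (ℕ →₀ ℝ) → ℝ := fun b => ultraNorm (b.support.sup id + 1) b x 0
  have hb : ∀ (b : ℕ →₀ ℝ) (j : ℕ), b.support.sup id + 1 ≤ j → b j = 0 := by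
    intro b j hj
    by_contra h
    have := Finset.le_sup (f := id) (Finsupp.mem_support_iff.2 h)
    simp only [id] at this
    omega
  have hp : ∀ (b : ℕ →₀ ℝ) (n : ℕ), (∀ j, n ≤ j → b j = 0) → p b = ultraNorm n b x 0 := by
    intro b n hn
    change ultraNorm _ _ _ _ = _
    rw [← ultraNorm_of_le (le_max_left _ n) (hb b), ultraNorm_of_le (le_max_right _ n) hn]
  have hbd : ∀ b : ℕ →₀ ℝ, ∃ n, ∀ j, n ≤ j → b j = 0 := fun b => ⟨_, hb b⟩
  let : Norm (ℕ →₀ ℝ) := ⟨p⟩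
  have core : NormedSpace.Core ℝ (ℕ →₀ ℝ) :=
    { norm_nonneg := fun b => (ultraNorm_bounds hx _ _ _).1
      norm_smul := fun c b => by
        obtain ⟨n, hn⟩ := hbd b
        change p _ = |c| * p _
        rw [hp b n hn, hp (c • b) n fun j hj => by simp [hn j hj], ← ultraNorm_smul hx]
        rw [smul_zero]
        rfl
      norm_triangle := fun b b' => by
        obtain ⟨n, hn⟩ := hbd b
        obtain ⟨n', hn'⟩ := hbd b'
        have h1 : ∀ j, max n n' ≤ j → b j = 0 := fun j hj => hn j (by omega)
        have h2 : ∀ j, max n n' ≤ j → b' j = 0 := fun j hj => hn' j (by omega)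
        change p _ ≤ p _ + p _
        rw [hp b _ h1, hp b' _ h2, hp (b + b') (max n n') fun j hj => by simp [h1 j hj, h2 j hj]]
        have := ultraNorm_add_le hx (max n n') b b' 0 0
        rw [add_zero] at this
        exact this
      norm_eq_zero_iff := fun b => by
        change p b = 0 ↔ _
        obtain ⟨n, hn⟩ := hbd b
        rw [hp b n hn]
        constructor
        · intro h
          have h1 := hlow n b
          rw [h] at h1
          have h2 : ∑ j ∈ range n, |b j| = 0 :=
            le_antisymm (nonpos_of_mul_nonpos_right h1 hδ)
              (Finset.sum_nonneg fun _ _ => abs_nonneg _)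
          rw [Finset.sum_eq_zero_iff_of_nonneg fun _ _ => abs_nonneg _] at h2
          ext j
          by_cases hj : j < n
          · simpa using h2 j (Finset.mem_range.2 hj)
          · simpa using hn j (not_lt.1 hj)
        · rintro rfl
          have := ultraNorm_smul hx n 0 0 0
          simp only [Pi.zero_apply, mul_zero, smul_zero, abs_zero, zero_mul] at this
          exact this }
  obtain ⟨E, T, hT⟩ := exists_normedSpc_of_core core
  refine ⟨E, fun j => T (Finsupp.single j 1), fun n b => ?_⟩
  simp only [← map_smul, ← map_sum, hT]
  change p (∑ j ∈ range n, b j • Finsupp.single j 1) = _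
  have hval : ∀ k, (∑ j ∈ range n, b j • Finsupp.single j (1 : ℝ)) k =
      if k < n then b k else 0 := by
    intro k
    simp [Finsupp.finsetSum_apply, Finsupp.single_apply]
  rw [hp _ n fun j hj => by rw [hval, if_neg (not_lt.2 hj)]]
  exact ultraNorm_congr n (fun j hj => by rw [hval, if_pos hj]) 0

theorem EquivToL1Basis.isCBasic {e : ℕ → E} (h : EquivToL1Basis e) : ∃ C : ℝ, IsCBasic C e := by
  obtain ⟨A, B, hA, hB, h⟩ := h
  refine ⟨B * A, fun i hi => ?_, fun n m hnm a => ?_⟩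
  · have := (h (i + 1) (Pi.single i 1)).1
    have h1 : ∑ j ∈ range (i + 1), (Pi.single i 1 : ℕ → ℝ) j • e j = 0 :=
      Finset.sum_eq_zero fun j _ => by
        rcases eq_or_ne j i with rfl | hj
        · simp [hi]
        · simp [hj]
    rw [h1, norm_zero] at this
    have h2 : (1 : ℝ) ≤ ∑ j ∈ range (i + 1), |(Pi.single i 1 : ℕ → ℝ) j| := by
      refine le_trans (by simp) (Finset.single_le_sum (f := fun j => |(Pi.single i 1 : ℕ → ℝ) j|)
        (fun _ _ => abs_nonneg _) (Finset.self_mem_range_succ i))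
    have h3 : 0 < A⁻¹ := by positivity
    nlinarith
  · have h1 := (h m a).1
    rw [inv_mul_le_iff₀ hA] at h1
    calc _ ≤ B * ∑ i ∈ range n, |a i| := (h n a).2
      _ ≤ B * ∑ i ∈ range m, |a i| := by
        gcongr
      _ ≤ B * (A * ‖∑ i ∈ range m, a i • e i‖) := by gcongr
      _ = _ := by ring

end Model

section WeakStarNullArrays

variable {x : ℕ → ℕ → X} {M : ℝ}

theorem le_ultraNorm_of_forall_le (hx : ∀ j i, ‖x j i‖ ≤ M) {r : ℝ} (n : ℕ) (b : ℕ → ℝ) (v : X)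
    (h : ∀ t : ℕ → ℕ, r ≤ ‖v + ∑ j ∈ range n, b j • x j (t j)‖) : r ≤ ultraNorm n b x v := by
  induction n generalizing b x v with
  | zero => simpa [ultraNorm] using h 0
  | succ n ih =>
    refine ge_of_tendsto' (tendsto_ultraNorm hx n b v) fun i => ?_
    refine ih (fun j => hx (j + 1)) _ _ fun t => (h fun j => Nat.casesOn j i t).trans (le_of_eq ?_)
    rw [Finset.sum_range_succ']
    change ‖v + (∑ k ∈ range n, b (k + 1) • x (k + 1) (t k) + b 0 • x 0 i)‖ = _
    rw [add_comm (∑ _ ∈ _, _), add_assoc]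

theorem ultraNorm_sum_le (hx : ∀ j i, ‖x j i‖ ≤ M) (n m : ℕ) (c : ℕ → ℝ) (b : ℕ → ℕ → ℝ) :
    ultraNorm n (fun j => ∑ k ∈ range m, c k * b k j) x 0 ≤
      ∑ k ∈ range m, |c k| * ultraNorm n (b k) x 0 := by
  induction m with
  | zero => simpa using (ultraNorm_smul hx n 0 0 0).le
  | succ m ih =>
    simp only [Finset.sum_range_succ]
    rw [← ultraNorm_smul hx n (c m) (b m) 0]
    have := ultraNorm_add_le hx n (fun j => ∑ k ∈ range m, c k * b k j) (fun j => c m * b m j) 0 0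
    rw [add_zero] at this
    rw [smul_zero]
    linarith

variable {d : ℕ → X} {dstar : ℕ → X →L[ℝ] ℝ} {C : ℝ}

/-- Let `x` be an array whose rows are coordinatewise null along the nonprincipal ultrafilter and
whose iterated ultrafilter limits dominate the `ℓ₁`-norm. Then normalizing and passing to
subsequences in each row gives a basic array with weak*-null rows which generates an asymptotic
model equivalent to the unit vector basis of `ℓ₁`. -/
theorem exists_weakStarNull_array (hd : IsCBasic C d)
    (hexp : ∀ y : X, Tendsto (fun n => partialSum d dstar n y) atTop (𝓝 y))
    (S : Submodule ℝ X) (hxS : ∀ j i, x j i ∈ S) (hx : ∀ j i, ‖x j i‖ ≤ M)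
    (hnull : ∀ j l, Tendsto (fun i => dstar l (x j i)) (hyperfilter ℕ) (𝓝 0))
    {δ : ℝ} (hδ : 0 < δ)
    (hlow : ∀ (n : ℕ) (b : ℕ → ℝ), δ * ∑ j ∈ range n, |b j| ≤ ultraNorm n b x 0) :
    ∃ (E : NormedSpc) (e : ℕ → E.carrier),
      Normalized e ∧ (∃ C : ℝ, IsCBasic C e) ∧
        (∃ xarr : ℕ → ℕ → X, IsBasicArray xarr ∧ (∀ n i, xarr n i ∈ S) ∧
          (∀ n, WeakStarNull dstar (xarr n)) ∧
          GeneratesAsymptoticModel xarr e) ∧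
        EquivToL1Basis e := by
  have := separableSpace_of_basis hexp
  set L : ℕ → ℝ := fun j => ulim fun i => ‖x j i‖ with hL
  have hLlim : ∀ j, Tendsto (fun i => ‖x j i‖) (hyperfilter ℕ) (𝓝 (L j)) := fun j =>
    tendsto_ulim fun i => (abs_norm (x j i)).trans_le (hx j i)
  have hLδ : ∀ j, δ ≤ L j := by
    intro j
    have h1 := hlow (j + 1) (Pi.single j 1)
    rw [ultraNorm_single] at h1
    have h2 : (1 : ℝ) ≤ ∑ i ∈ range (j + 1), |(Pi.single j 1 : ℕ → ℝ) i| := by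
      refine le_trans (by simp) (Finset.single_le_sum (f := fun i => |(Pi.single j 1 : ℕ → ℝ) i|)
        (fun _ _ => abs_nonneg _) (Finset.self_mem_range_succ j))
    nlinarith
  have hLpos : ∀ j, 0 < L j := fun j => hδ.trans_le (hLδ j)
  have hLM : ∀ j, L j ≤ M := fun j => le_of_tendsto' (hLlim j) (hx j)
  have hM : 0 < M := (hLpos 0).trans_le (hLM 0)
  have hLinv : ∀ j, Tendsto (fun i => ‖x j i‖⁻¹) (hyperfilter ℕ) (𝓝 (L j)⁻¹) := fun j =>
    (hLlim j).inv₀ (hLpos j).ne'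
  set z : ℕ → ℕ → X := fun j i => ‖x j i‖⁻¹ • x j i with hz
  have hz0 : ∀ j i, x j i ≠ 0 → ‖z j i‖ = 1 := fun j i h => by
    simp only [hz]
    rw [norm_smul, norm_inv, norm_norm, inv_mul_cancel₀ (norm_ne_zero_iff.2 h)]
  have hz1 : ∀ j i, ‖z j i‖ ≤ 1 := fun j i => by
    by_cases h : x j i = 0
    · simp [hz, h]
    · exact (hz0 j i h).le
  have hzS : ∀ j i, z j i ∈ S := fun j i => S.smul_mem _ (hxS j i)
  have hznull : ∀ j l, Tendsto (fun i => dstar l (z j i)) (hyperfilter ℕ) (𝓝 0) := by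
    intro j l
    simpa [hz] using (hLinv j).mul (hnull j l)
  have hzeq : ∀ n b v, ultraNorm n b z v = ultraNorm n (fun j => b j * (L j)⁻¹) x v := by
    intro n b v
    rw [← ultraNorm_mul]
    refine ultraNorm_eq_of_tendsto (M := max 1 (δ⁻¹ * M))
      (fun j i => (hz1 j i).trans (le_max_left _ _)) (fun j i => ?_) (fun j => ?_) n b v
    · refine le_trans ?_ (le_max_right _ _)
      rw [norm_smul, norm_inv, Real.norm_eq_abs, abs_of_pos (hLpos j)]
      have := hLδ j
      have := hx j i
      gcongr
    · have h1 : Tendsto (fun i => |‖x j i‖⁻¹ - (L j)⁻¹| * M) (hyperfilter ℕ) (𝓝 0) := by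
        simpa using (((hLinv j).sub_const (L j)⁻¹).abs).mul_const M
      refine squeeze_zero_norm (fun i => ?_) h1
      rw [hz, ← sub_smul, norm_smul, Real.norm_eq_abs]
      gcongr
      exact hx j i
  have hzlow : ∀ (n : ℕ) (b : ℕ → ℝ), δ / M * ∑ j ∈ range n, |b j| ≤ ultraNorm n b z 0 := by
    intro n b
    rw [hzeq]
    refine le_trans ?_ (hlow n _)
    rw [div_mul_eq_mul_div, mul_div_assoc, Finset.sum_div]
    gcongr with j hj
    rw [abs_mul, abs_inv, abs_of_pos (hLpos j), div_eq_mul_inv]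
    have := hLM j
    have := hLpos j
    gcongr
  have hzlim : ∀ j, (ulim fun i => ‖z j i‖) = 1 := by
    intro j
    refine ulim_eq (tendsto_const_nhds.congr' ?_)
    filter_upwards [(hLlim j).eventually (lt_mem_nhds (hLpos j))] with i hi
    exact (hz0 j i (norm_pos_iff.1 hi)).symm
  have hrow : ∀ k, ∃ s : ℕ → ℕ, (∀ l, Tendsto (fun i => dstar l (z k (s i))) atTop (𝓝 0)) ∧
      ∀ (n : ℕ) (b : ℕ → ℝ) (v : X), Tendsto (fun i =>
        ultraNorm n (fun j => b (j + 1)) (fun j => z (k + (j + 1))) (v + b 0 • z k (s i)))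
        atTop (𝓝 (ultraNorm (n + 1) b (fun j => z (k + j)) v)) := fun k =>
    exists_subseq_tendsto_ultraNorm (x := fun j => z (k + j)) (fun j => hz1 (k + j)) (hznull k)
  choose s hsnull hslim using hrow
  have hsnorm : ∀ k, ∀ᶠ i in atTop, ‖z k (s k i)‖ = 1 := by
    intro k
    have h1 := hslim k 0 1 0
    simp only [ultraNorm, Pi.one_apply, one_smul, zero_add, add_zero, hzlim] at h1
    filter_upwards [h1.eventually (lt_mem_nhds one_pos)] with i hi
    refine hz0 _ _ fun h => ?_
    simp [hz, h] at hi
  obtain ⟨m, hm, hm1, hbasic⟩ := exists_isCBasic_selection hd hexp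
    (u := fun k i => z (Nat.unpair k).1 (s (Nat.unpair k).1 i))
    (fun k => hsnorm _) (fun k => hsnull _)
  have hmtop : ∀ k, Tendsto (fun i => m (Nat.pair k i)) atTop atTop := fun k =>
    tendsto_atTop_mono (fun i => (Nat.right_le_pair k i).trans (hm _)) tendsto_id
  obtain ⟨E, e, he⟩ := exists_normedSpc_ultraNorm hz1 (div_pos hδ hM) hzlow
  have hequiv : EquivToL1Basis e := by
    refine ⟨(δ / M)⁻¹, 1, by positivity, one_pos, fun n c => ?_⟩
    rw [inv_inv, he]
    exact ⟨hzlow n c, by simpa using (ultraNorm_bounds hz1 n c 0).2⟩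
  refine ⟨E, e, fun j => ?_, hequiv.isCBasic,
    ⟨fun j i => z j (s j (m (Nat.pair j i))), ⟨2 * C, ?_⟩, fun n i => hzS _ _,
      fun n => ⟨⟨1, fun i => hz1 _ _⟩, fun l => (hsnull n l).comp (hmtop n)⟩,
      fun n b => ?_⟩, hequiv⟩
  · have h1 := he (j + 1) (Pi.single j 1)
    rw [ultraNorm_single, hzlim, Finset.sum_eq_single j] at h1
    · simpa using h1
    · intro i _ hij
      simp [hij]
    · simp
  · refine isBasicArrayWith_of_isCBasic_unpair (fun j i => ?_) ?_
    · simpa using hm1 (Nat.pair j i)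
    · simpa using hbasic
  · rw [he]
    simpa using iteratedLimit_ultraNorm (x := z) (s := fun k i => s k (m (Nat.pair k i)))
      (fun k n b v => (hslim k n b v).comp (hmtop k)) n 0 b 0

end WeakStarNullArrays

section Dichotomy

/-- Differences of distinct terms of a sequence satisfying a lower `ℓ₁`-estimate again satisfy
it. -/
theorem le_norm_sum_sub_of_lower_l1 {V : ℕ → X} {δ : ℝ} (hδ : 0 ≤ δ)
    (hV : ∀ (m : ℕ) (c : ℕ → ℝ), δ * ∑ k ∈ range m, |c k| ≤ ‖∑ k ∈ range m, c k • V k‖)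
    {g h : ℕ → ℕ} (hg : Function.Injective g) (hgh : ∀ i j, g i ≠ h j) (n : ℕ) (b : ℕ → ℝ) :
    δ * ∑ j ∈ range n, |b j| ≤ ‖∑ j ∈ range n, b j • (V (g j) - V (h j))‖ := by
  obtain ⟨m, hm⟩ : ∃ m, ∀ j < n, g j < m ∧ h j < m := by
    refine ⟨(range n).sup g + (range n).sup h + 1, fun j hj => ?_⟩
    have h1 := Finset.le_sup (f := g) (Finset.mem_range.2 hj)
    have h2 := Finset.le_sup (f := h) (Finset.mem_range.2 hj)
    omega
  set c : ℕ → ℝ := fun k =>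
    ∑ j ∈ range n, b j * ((if g j = k then 1 else 0) - if h j = k then 1 else 0) with hc
  have h1 : ∑ j ∈ range n, b j • (V (g j) - V (h j)) = ∑ k ∈ range m, c k • V k := by
    simp only [hc, Finset.sum_smul]
    rw [Finset.sum_comm]
    refine Finset.sum_congr rfl fun j hj => ?_
    have := hm j (Finset.mem_range.1 hj)
    simp [mul_sub, sub_smul, Finset.sum_sub_distrib, smul_sub, this.1, this.2]
  have h2 : ∀ j < n, c (g j) = b j := by
    intro j hj
    simp only [hc, hg.eq_iff, (hgh _ _).symm, if_false, sub_zero]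
    simp [hj]
  rw [h1]
  refine le_trans (mul_le_mul_of_nonneg_left ?_ hδ) (hV m c)
  calc ∑ j ∈ range n, |b j| = ∑ j ∈ range n, |c (g j)| :=
        Finset.sum_congr rfl fun j hj => by rw [h2 j (Finset.mem_range.1 hj)]
    _ = ∑ k ∈ (range n).image g, |c k| := by
        rw [Finset.sum_image fun _ _ _ _ hh => hg hh]
    _ ≤ _ := by
        refine Finset.sum_le_sum_of_subset_of_nonneg ?_ fun _ _ _ => abs_nonneg _
        intro k hk
        obtain ⟨j, hj, rfl⟩ := Finset.mem_image.1 hk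
        exact Finset.mem_range.2 (hm j (Finset.mem_range.1 hj)).1

/-- Let `y` be an array with a lower `ℓ₁`-estimate in the limit and `w` a sequence such that no
tail of the array of differences `y j i - w j` has such an estimate. Then some sequence of
successive absolutely convex blocks of `w` has a lower `ℓ₁`-estimate. -/
theorem exists_blocks_lower_l1 {y : ℕ → ℕ → X} {w : ℕ → X} {M W δ : ℝ}
    (hx : ∀ j i, ‖y j i - w j‖ ≤ M) (hw : ∀ j, ‖w j‖ ≤ W)
    (hδ : 0 < δ)
    (hlow : ∀ (n : ℕ) (b : ℕ → ℝ), 2 * δ * ∑ j ∈ range n, |b j| ≤ ultraNorm n b y 0)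
    (hsmall : ∀ N, ∃ (n : ℕ) (b : ℕ → ℝ), (∀ j < N, b j = 0) ∧
      ultraNorm n b (fun j i => y j i - w j) 0 < δ * ∑ j ∈ range n, |b j|)
    (S : Submodule ℝ X) (hwS : ∀ j, w j ∈ S) :
    ∃ V : ℕ → X, (∀ k, V k ∈ S) ∧ (∀ k, ‖V k‖ ≤ W) ∧
      ∀ (m : ℕ) (c : ℕ → ℝ), δ * ∑ k ∈ range m, |c k| ≤ ‖∑ k ∈ range m, c k • V k‖ := by
  have hnormal : ∀ N, ∃ (n : ℕ) (b : ℕ → ℝ), N ≤ n ∧ (∀ j < N, b j = 0) ∧ (∀ j, n ≤ j → b j = 0) ∧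
      ∑ j ∈ range n, |b j| = 1 ∧ ultraNorm n b (fun j i => y j i - w j) 0 ≤ δ := by
    intro N
    obtain ⟨n, b, hb, hlt⟩ := hsmall N
    set q := ∑ j ∈ range n, |b j| with hq
    have hq0 : 0 < q := by
      have := (ultraNorm_bounds hx n b 0).1
      exact pos_of_mul_pos_right (this.trans_lt hlt) hδ.le
    refine ⟨n, fun j => if j < n then q⁻¹ * b j else 0, ?_, fun j hj => ?_, fun j hj => ?_, ?_, ?_⟩
    · by_contra hn
      refine hq0.ne' (Finset.sum_eq_zero fun j hj => ?_)
      rw [hb j (by have := Finset.mem_range.1 hj; omega), abs_zero]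
    · simp [hb j hj]
    · simp [not_lt.2 hj]
    · have hscale : ∀ j ∈ range n, |if j < n then q⁻¹ * b j else 0| = q⁻¹ * |b j| := fun j hj => by
        rw [if_pos (Finset.mem_range.1 hj), abs_mul, abs_of_pos (inv_pos.2 hq0)]
      rw [Finset.sum_congr rfl hscale, ← Finset.mul_sum, inv_mul_cancel₀ hq0.ne']
    · rw [ultraNorm_congr (b' := fun j => q⁻¹ * b j) n fun j hj => if_pos hj]
      have := ultraNorm_smul hx n q⁻¹ b 0
      rw [smul_zero, abs_of_pos (inv_pos.2 hq0)] at this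
      rw [this, inv_mul_le_iff₀ hq0, mul_comm]
      exact hlt.le
  choose nn β hnn hβ0 hβ1 hβs hβδ using hnormal
  let Ns : ℕ → ℕ := fun k => Nat.rec 0 (fun _ N => nn N) k
  have hmono : Monotone Ns := monotone_nat_of_le_succ fun k => hnn (Ns k)
  set b : ℕ → ℕ → ℝ := fun k => β (Ns k) with hb
  have hblow : ∀ k, ∀ j < Ns k, b k j = 0 := fun k => hβ0 (Ns k)
  have hbhigh : ∀ k j, Ns (k + 1) ≤ j → b k j = 0 := fun k => hβ1 (Ns k)
  have hbs : ∀ k, ∑ j ∈ range (Ns (k + 1)), |b k j| = 1 := fun k => hβs (Ns k)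
  have hbδ : ∀ k, ultraNorm (Ns (k + 1)) (b k) (fun j i => y j i - w j) 0 ≤ δ :=
    fun k => hβδ (Ns k)
  refine ⟨fun k => ∑ j ∈ range (Ns (k + 1)), b k j • w j,
    fun k => S.sum_mem fun j _ => S.smul_mem _ (hwS j), fun k => ?_, fun m c => ?_⟩
  · calc _ ≤ ∑ j ∈ range (Ns (k + 1)), |b k j| * W := by
          refine norm_sum_le_of_le _ fun j _ => ?_
          rw [norm_smul, Real.norm_eq_abs]
          gcongr
          exact hw j
      _ = W := by rw [← Finset.sum_mul, hbs, one_mul]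
  · set a : ℕ → ℝ := fun j => ∑ k ∈ range m, c k * b k j with ha
    have habs : ∀ m j, |∑ k ∈ range m, c k * b k j| = ∑ k ∈ range m, |c k| * |b k j| := by
      intro m j
      induction m with
      | zero => simp
      | succ m ih =>
        rw [Finset.sum_range_succ, Finset.sum_range_succ]
        by_cases hj : b m j = 0
        · simp [hj, ih]
        · have hz : ∀ k ∈ range m, b k j = 0 := fun k hk =>
            hbhigh k j ((hmono (Finset.mem_range.1 hk)).trans (not_lt.1 fun h => hj (hblow m j h)))
          rw [Finset.sum_eq_zero fun k hk => by rw [hz k hk, mul_zero],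
            Finset.sum_eq_zero fun k hk => by rw [hz k hk, abs_zero, mul_zero], zero_add, zero_add,
            abs_mul]
    have hasum : ∑ j ∈ range (Ns m), |a j| = ∑ k ∈ range m, |c k| := by
      simp only [ha, habs]
      rw [Finset.sum_comm]
      refine Finset.sum_congr rfl fun k hk => ?_
      have hsub : ∑ j ∈ range (Ns (k + 1)), |b k j| = ∑ j ∈ range (Ns m), |b k j| :=
        Finset.sum_subset (Finset.range_subset_range.2 (hmono (Finset.mem_range.1 hk)))
          fun j _ hj => by rw [hbhigh k j (by simpa using hj), abs_zero]
      rw [← Finset.mul_sum, ← hsub, hbs, mul_one]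
    have haV : ∑ k ∈ range m, c k • ∑ j ∈ range (Ns (k + 1)), b k j • w j =
        ∑ j ∈ range (Ns m), a j • w j := by
      simp only [ha, Finset.sum_smul]
      rw [Finset.sum_comm]
      refine Finset.sum_congr rfl fun k hk => ?_
      have hsub : ∑ j ∈ range (Ns (k + 1)), b k j • w j = ∑ j ∈ range (Ns m), b k j • w j :=
        Finset.sum_subset (Finset.range_subset_range.2 (hmono (Finset.mem_range.1 hk)))
          fun j _ hj => by rw [hbhigh k j (by simpa using hj), zero_smul]
      rw [hsub, Finset.smul_sum]
      simp only [mul_smul]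
    rw [haV]
    have h1 := hlow (Ns m) a
    rw [hasum, ← ultraNorm_sub (Ns m) a w 0, zero_add] at h1
    have h2 : ultraNorm (Ns m) a (fun j i => y j i - w j) (∑ j ∈ range (Ns m), a j • w j) ≤
        ultraNorm (Ns m) a (fun j i => y j i - w j) 0 + ‖∑ j ∈ range (Ns m), a j • w j‖ := by
      have h3 := ultraNorm_add_le hx (Ns m) a (fun _ => 0) 0 (∑ j ∈ range (Ns m), a j • w j)
      have h4 := (ultraNorm_bounds hx (Ns m) (fun _ => 0) (∑ j ∈ range (Ns m), a j • w j)).2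
      simp only [add_zero, zero_add, abs_zero, Finset.sum_const_zero, mul_zero] at h3 h4
      linarith
    have h5 : ultraNorm (Ns m) a (fun j i => y j i - w j) 0 ≤ δ * ∑ k ∈ range m, |c k| := by
      refine (ultraNorm_sum_le hx (Ns m) m c b).trans ?_
      rw [Finset.mul_sum]
      refine Finset.sum_le_sum fun k hk => ?_
      rw [ultraNorm_of_le (hmono (Finset.mem_range.1 hk)) (hbhigh k), mul_comm δ]
      exact mul_le_mul_of_nonneg_left (hbδ k) (abs_nonneg _)
    linarith

end Dichotomy

/-- Proposition 3.11: if `Y` has a boundedly complete basis `d` (with coordinate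
functionals `dstar`), `X ⊆ Y` is a weak*-closed subspace, and `ℓ₁` is an asymptotic
model of `X`, then `ℓ₁` is an asymptotic model of `X` generated by a basic array whose
rows are weak*-null. -/
theorem stmt_10 {Y : Type*} [NormedAddCommGroup Y] [NormedSpace ℝ Y] [CompleteSpace Y]
    (d : ℕ → Y) (dstar : ℕ → Y →L[ℝ] ℝ)
    (hd : ∃ C : ℝ, IsCBasic C d)
    (hbiorth : ∀ i j, dstar i (d j) = if i = j then (1 : ℝ) else 0)
    (hexp : ∀ y : Y, Filter.Tendsto (fun n => ∑ i ∈ Finset.range n, dstar i y • d i)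
      Filter.atTop (nhds y))
    (hboundedlycomplete : ∀ a : ℕ → ℝ,
      (∃ M : ℝ, ∀ n, ‖∑ i ∈ Finset.range n, a i • d i‖ ≤ M) →
      ∃ y : Y, Filter.Tendsto (fun n => ∑ i ∈ Finset.range n, a i • d i)
        Filter.atTop (nhds y))
    (Xs : Submodule ℝ Y)
    (hXweakstarclosed : ∀ (x : ℕ → Y) (y : Y), (∀ n, x n ∈ Xs) →
      (∃ M : ℝ, ∀ n, ‖x n‖ ≤ M) →
      (∀ j, Filter.Tendsto (fun n => dstar j (x n)) Filter.atTop (nhds (dstar j y))) →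
      y ∈ Xs)
    (hyp : ∃ (E : NormedSpc) (e : ℕ → E.carrier),
      Normalized e ∧ (∃ C : ℝ, IsCBasic C e) ∧
        (∃ yarr : ℕ → ℕ → Y, IsBasicArray yarr ∧ (∀ n i, yarr n i ∈ Xs) ∧
          GeneratesAsymptoticModel yarr e) ∧
        EquivToL1Basis e) :
    ∃ (E : NormedSpc) (e : ℕ → E.carrier),
      Normalized e ∧ (∃ C : ℝ, IsCBasic C e) ∧
        (∃ xarr : ℕ → ℕ → Y, IsBasicArray xarr ∧ (∀ n i, xarr n i ∈ Xs) ∧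
          (∀ n, WeakStarNull dstar (xarr n)) ∧
          GeneratesAsymptoticModel xarr e) ∧
        EquivToL1Basis e := by
  obtain ⟨E, e, -, -, ⟨y, ⟨K, hK⟩, hyS, hgen⟩, A, B, hA, -, hAB⟩ := hyp
  obtain ⟨C, hd⟩ := hd
  have hexp' : ∀ z : Y, Tendsto (fun n => partialSum d dstar n z) atTop (𝓝 z) := hexp
  have hy1 : ∀ j i, ‖y j i‖ ≤ 1 := fun j i => ((hK.1 j).1 i).le
  set δ : ℝ := A⁻¹ / 2 with hδA
  have hδ : 0 < δ := by positivity
  have hylow : ∀ (n : ℕ) (b : ℕ → ℝ), 2 * δ * ∑ j ∈ range n, |b j| ≤ ultraNorm n b y 0 := by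
    intro n b
    rw [ultraNorm_eq_of_iteratedLimit n b 0 (by simpa using hgen n b), hδA,
      mul_div_cancel₀ _ two_ne_zero]
    exact (hAB n b).1
  choose w hwC hwlim using fun j =>
    exists_coordinatewise_ulim hd hbiorth hexp' hboundedlycomplete (hy1 j)
  have hwS : ∀ j, w j ∈ Xs := by
    intro j
    obtain ⟨s, -, hs⟩ := exists_subseq_of_tendsto_hyperfilter
      (h := fun i l => dstar l (y j i)) (tendsto_pi_nhds.2 (hwlim j))
    exact hXweakstarclosed (fun i => y j (s i)) (w j) (fun i => hyS j _) ⟨1, fun i => hy1 j _⟩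
      (tendsto_pi_nhds.1 hs)
  have hx : ∀ j i, ‖y j i - w j‖ ≤ 1 + C * 1 := fun j i =>
    (norm_sub_le _ _).trans (add_le_add (hy1 j i) (hwC j))
  by_cases hcase : ∃ N, ∀ (n : ℕ) (b : ℕ → ℝ), (∀ j < N, b j = 0) →
      δ * ∑ j ∈ range n, |b j| ≤ ultraNorm n b (fun j i => y j i - w j) 0
  · obtain ⟨N, hN⟩ := hcase
    refine exists_weakStarNull_array (x := fun j i => y (N + j) i - w (N + j)) hd hexp' Xs
      (fun j i => Xs.sub_mem (hyS _ _) (hwS _)) (fun j i => hx _ _) (fun j l => ?_) hδ fun n b => ?_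
    · simpa using (hwlim (N + j) l).sub_const (dstar l (w (N + j)))
    · have h1 := hN (N + n) (fun j => if j < N then 0 else b (j - N)) fun j hj => if_pos hj
      rw [ultraNorm_add_of_zero_below N n (fun j hj => if_pos hj),
        Finset.sum_range_add, Finset.sum_eq_zero fun j hj => by
          rw [if_pos (Finset.mem_range.1 hj), abs_zero]] at h1
      simpa using h1
  · push Not at hcase
    obtain ⟨V, hVS, hVC, hVlow⟩ := exists_blocks_lower_l1 hx hwC hδ hylow hcase Xs hwS
    obtain ⟨v, -, hv⟩ := exists_coordinatewise_ulim hd hbiorth hexp' hboundedlycomplete hVC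
    obtain ⟨φ, hφ, hφv⟩ := exists_subseq_of_tendsto_hyperfilter
      (h := fun i l => dstar l (V i)) (tendsto_pi_nhds.2 hv)
    have hpair : ∀ j, Tendsto (fun i => Nat.pair j i) atTop atTop := fun j =>
      tendsto_atTop_mono (fun i => Nat.right_le_pair j i) tendsto_id
    refine exists_weakStarNull_array
      (x := fun j i => V (φ (2 * Nat.pair j i)) - V (φ (2 * Nat.pair j i + 1))) hd hexp' Xs
      (fun j i => Xs.sub_mem (hVS _) (hVS _))
      (fun j i => (norm_sub_le _ _).trans (add_le_add (hVC _) (hVC _))) (fun j l => ?_) hδ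
      fun n b => ?_
    · have hl : Tendsto (fun i => dstar l (V (φ i))) atTop (𝓝 (dstar l v)) :=
        tendsto_pi_nhds.1 hφv l
      have h0 := hl.comp (tendsto_atTop_mono (fun i => by omega) (hpair j) :
        Tendsto (fun i => 2 * Nat.pair j i) atTop atTop)
      have h1 := hl.comp (tendsto_atTop_mono (fun i => by omega) (hpair j) :
        Tendsto (fun i => 2 * Nat.pair j i + 1) atTop atTop)
      simpa using (h0.sub h1).mono_left hyperfilter_le_atTop
    · refine le_ultraNorm_of_forall_le
        (fun j i => (norm_sub_le _ _).trans (add_le_add (hVC _) (hVC _))) n b 0 fun t => ?_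
      rw [zero_add]
      refine le_norm_sum_sub_of_lower_l1 hδ.le hVlow
        (g := fun j => φ (2 * Nat.pair j (t j))) (h := fun j => φ (2 * Nat.pair j (t j) + 1))
        (fun i j hij => ?_) (fun i j hij => ?_) n b
      · have := hφ.injective hij
        exact (Nat.pair_eq_pair.1 (by omega : Nat.pair i (t i) = Nat.pair j (t j))).1
      · have := hφ.injective hij
        omega
end
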